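/- arXiv:1608.03482 — 8 statements merged into one kernel-verified Lean document; each statement's English description precedes it below -/
import Mathlib

section
/- Let 𝒞 be a non-trivial extension-closed pseudovariety of groups and let F be a free group of arbitrary rank. Then F is 𝒞-hereditarily conjugacy separable, i.e., every subgroup of F that is open in the pro-𝒞 topology on F is 𝒞-conjugacy separable. -/
/-- A bundled group (in universe 0). -/
structure GrpB where
  carrier : Type
  str : Group carrier

attribute [instance] GrpB.str

/-- Bundle a group type. -/
def GrpB.of (G : Type) [h : Group G] : GrpB := ⟨G, h⟩

/-- `C` is a pseudovariety of groups: closed under isomorphism, subgroups,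
binary direct products and quotients. -/
def IsPseudovariety (C : GrpB → Prop) : Prop :=
  (∀ A B : GrpB, C A → Nonempty (B.carrier ≃* A.carrier) → C B) ∧
  (∀ (A : GrpB) (H : Subgroup A.carrier), C A → C (GrpB.of H)) ∧
  (∀ A B : GrpB, C A → C B → C (GrpB.of (A.carrier × B.carrier))) ∧
  (∀ (A : GrpB) (N : Subgroup A.carrier) [N.Normal], C A → C (GrpB.of (A.carrier ⧸ N)))

/-- `C` is extension-closed. -/
def IsExtensionClosed (C : GrpB → Prop) : Prop :=
  ∀ (A : GrpB) (N : Subgroup A.carrier) [N.Normal],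
    C (GrpB.of N) → C (GrpB.of (A.carrier ⧸ N)) → C A

/-- Every member of `C` is a finite group. -/
def ClassOfFiniteGroups (C : GrpB → Prop) : Prop := ∀ A : GrpB, C A → Finite A.carrier

/-- `C` contains at least one non-trivial group. -/
def ClassNontrivial (C : GrpB → Prop) : Prop := ∃ A : GrpB, C A ∧ ∃ a : A.carrier, a ≠ 1

/-- `P` is residually-`C`. -/
def ResiduallyC (C : GrpB → Prop) (P : Type) [Group P] : Prop :=
  ∀ p : P, p ≠ 1 → ∃ M : GrpB, C M ∧ ∃ φ : P →* M.carrier, φ p ≠ 1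

/-- `G` is `C`-conjugacy separable. -/
def ConjSepC (C : GrpB → Prop) (G : Type) [Group G] : Prop :=
  ∀ x y : G, ¬ IsConj x y → ∃ M : GrpB, C M ∧ ∃ φ : G →* M.carrier, ¬ IsConj (φ x) (φ y)

/-- `N` is a co-`C` (normal) subgroup of `F`. -/
def IsCoC (C : GrpB → Prop) {F : Type} [Group F] (N : Subgroup F) : Prop :=
  ∃ hn : N.Normal, letI := hn; C (GrpB.of (F ⧸ N))

/-- The pro-`C` topology on `F`: generated by the cosets of co-`C` subgroups. -/
def ProCTop (C : GrpB → Prop) (F : Type) [Group F] : TopologicalSpace F :=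
  TopologicalSpace.generateFrom
    {S : Set F | ∃ N : Subgroup F, IsCoC C N ∧ ∃ g : F, S = {x : F | g⁻¹ * x ∈ N}}

/-- `X` is closed in the pro-`C` topology on `F`. -/
def CClosed (C : GrpB → Prop) {F : Type} [Group F] (X : Set F) : Prop :=
  @IsClosed F (ProCTop C F) X

/-- `X` is open in the pro-`C` topology on `F`. -/
def COpen (C : GrpB → Prop) {F : Type} [Group F] (X : Set F) : Prop :=
  @IsOpen F (ProCTop C F) X

/-- Closure of `X` in the pro-`C` topology on `F`. -/
def CClosure (C : GrpB → Prop) {F : Type} [Group F] (X : Set F) : Set F :=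
  @closure F (ProCTop C F) X

/-- `F` is `C`-hereditarily conjugacy separable: every `C`-open subgroup is
`C`-conjugacy separable. -/
def HerConjSepC (C : GrpB → Prop) (F : Type) [Group F] : Prop :=
  ∀ H : Subgroup F, COpen C (H : Set F) → ConjSepC C H

/-- `M` is cyclic subgroup `C`-separable: every cyclic subgroup is `C`-closed. -/
def CyclicSubgroupSepC (C : GrpB → Prop) (M : Type) [Group M] : Prop :=
  ∀ m : M, CClosed C ((Subgroup.zpowers m : Subgroup M) : Set M)

/-- `M` is highly residually-`C`: every extension of a `C`-group by `M` is residually-`C`. -/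
def HighlyResiduallyC (C : GrpB → Prop) (M : Type) [Group M] : Prop :=
  ∀ (L : Type) [Group L], ∀ (K : Subgroup L) [K.Normal],
    C (GrpB.of K) → Nonempty ((L ⧸ K) ≃* M) → ResiduallyC C L

/-- `F` has cyclic centralizers. -/
def HasCyclicCentralizers (F : Type) [Group F] : Prop :=
  ∀ f : F, f ≠ 1 → IsCyclic (Subgroup.centralizer ({f} : Set F))

/-- `G ≤ F₁ × F₂` is a subdirect product. -/
def IsSubdirect {F₁ F₂ : Type} [Group F₁] [Group F₂] (G : Subgroup (F₁ × F₂)) : Prop :=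
  Subgroup.map (MonoidHom.fst F₁ F₂) G = ⊤ ∧ Subgroup.map (MonoidHom.snd F₁ F₂) G = ⊤

/-- `G ≤ F₁ × F₂` is a full subdirect product. -/
def IsFullSubdirect {F₁ F₂ : Type} [Group F₁] [Group F₂] (G : Subgroup (F₁ × F₂)) : Prop :=
  IsSubdirect G ∧ Subgroup.comap (MonoidHom.inl F₁ F₂) G ≠ ⊥ ∧
    Subgroup.comap (MonoidHom.inr F₁ F₂) G ≠ ⊥

/-- `F` is a free group (of arbitrary rank). -/
def IsFreeGroupType (F : Type) [Group F] : Prop := ∃ S : Type, Nonempty (F ≃* FreeGroup S)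

/-- `F` is a non-abelian free group. -/
def IsNonAbelianFree (F : Type) [Group F] : Prop :=
  IsFreeGroupType F ∧ ∃ a b : F, a * b ≠ b * a

/-- The class of finite `p`-groups. -/
def CP (p : ℕ) : GrpB → Prop := fun A => Finite A.carrier ∧ IsPGroup p A.carrier

/-- The class of all finite groups. -/
def CFin : GrpB → Prop := fun A => Finite A.carrier

/-- A `Q'`-group: every element has finite order coprime to every `q ∈ Q`. -/
def IsQPrimeGroup (Q : Set ℕ) (F : Type) [Group F] : Prop :=
  ∀ f : F, IsOfFinOrder f ∧ ∀ q ∈ Q, Nat.Coprime (orderOf f) q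

/-- Some homomorphism to a finite `p`-group maps `x` and `y` to non-conjugate elements. -/
def PConjSeparated (p : ℕ) {G : Type} [Group G] (x y : G) : Prop :=
  ∃ (P : Type) (_ : Group P), Finite P ∧ IsPGroup p P ∧ ∃ φ : G →* P, ¬ IsConj (φ x) (φ y)

theorem PConjSeparated.symm {p : ℕ} {G : Type} [Group G] {x y : G}
    (h : PConjSeparated p x y) : PConjSeparated p y x := by
  obtain ⟨P, hP, hfin, hp, φ, hφ⟩ := h
  exact ⟨P, hP, hfin, hp, φ, fun h => hφ h.symm⟩

theorem PConjSeparated.of_comm {p : ℕ} {G P : Type} [Group G] [CommGroup P] [Finite P]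
    (hP : IsPGroup p P) (φ : G →* P) {x y : G} (h : φ x ≠ φ y) : PConjSeparated p x y :=
  ⟨P, inferInstance, inferInstance, hP, φ, fun hc => h (isConj_iff_eq.1 hc)⟩

theorem isPGroup_multiplicative_zmod (p : ℕ) [Fact p.Prime] :
    IsPGroup p (Multiplicative (ZMod p)) :=
  IsPGroup.of_card (n := 1) (by simp)

theorem isPGroup_multiplicative_zmod_pow (p k : ℕ) [Fact p.Prime] :
    IsPGroup p (Multiplicative (ZMod (p ^ k))) :=
  IsPGroup.of_card (n := k) (by simp)

/-- The homomorphism of regular wreath products induced by a homomorphism of the base groups. -/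
def RegularWreathProduct.mapBase {D E : Type} (Q : Type) [Group D] [Group E] [Group Q]
    (f : D →* E) : RegularWreathProduct D Q →* RegularWreathProduct E Q where
  toFun w := ⟨fun i => f (w.left i), w.right⟩
  map_one' := by ext <;> simp
  map_mul' a b := by ext <;> simp

theorem RegularWreathProduct.exists_isConj_left {D Q : Type} [Group D] [Group Q]
    {a b : RegularWreathProduct D Q} (ha : a.right = 1) (h : IsConj a b) (i : Q) :
    ∃ j, IsConj (a.left j) (b.left i) := by
  obtain ⟨c, rfl⟩ := isConj_iff.1 h
  refine ⟨c.right⁻¹ * i, isConj_iff.2 ⟨c.left i, ?_⟩⟩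
  simp [ha]

theorem IsPGroup.regularWreathProduct {p : ℕ} [Fact p.Prime] {D Q : Type} [Group D] [Group Q]
    [Finite D] [Finite Q] (hD : IsPGroup p D) (hQ : IsPGroup p Q) :
    IsPGroup p (RegularWreathProduct D Q) := by
  obtain ⟨m, hm⟩ := IsPGroup.iff_card.1 hD
  obtain ⟨n, hn⟩ := IsPGroup.iff_card.1 hQ
  refine IsPGroup.of_card (n := m * p ^ n + n) ?_
  rw [RegularWreathProduct.card, hm, hn, pow_add, pow_mul]

theorem IsPGroup.pi_finite {p : ℕ} [Fact p.Prime] {ι : Type} [Finite ι] {P : ι → Type}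
    [∀ i, Group (P i)] [∀ i, Finite (P i)] (h : ∀ i, IsPGroup p (P i)) :
    IsPGroup p (∀ i, P i) := by
  have := Fintype.ofFinite ι
  choose n hn using fun i => IsPGroup.iff_card.1 (h i)
  refine IsPGroup.of_card (n := ∑ i, n i) ?_
  rw [Nat.card_pi, ← Finset.prod_pow_eq_pow_sum]
  exact Finset.prod_congr rfl fun i _ => hn i

/-- If a component of `θ y` is separated from every component of `θ x`, where `θ` takes values in
a wreath product with a finite `p`-group and `θ x` lies in the base, then `x` and `y` are
separated. -/
theorem PConjSeparated.of_wreath {p : ℕ} [Fact p.Prime] {G D Q : Type} [Group G] [Group D]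
    [Group Q] [Finite Q] (hQ : IsPGroup p Q) (θ : G →* RegularWreathProduct D Q) {x y : G}
    (hx : (θ x).right = 1) (i : Q)
    (h : ∀ j, PConjSeparated p ((θ x).left j) ((θ y).left i)) : PConjSeparated p x y := by
  choose P hG hfin hP ψ hψ using h
  refine ⟨RegularWreathProduct (∀ j, P j) Q, inferInstance, inferInstance,
    (IsPGroup.pi_finite hP).regularWreathProduct hQ,
    (RegularWreathProduct.mapBase Q (MonoidHom.pi ψ)).comp θ, fun hc => ?_⟩
  obtain ⟨j, hj⟩ := RegularWreathProduct.exists_isConj_left (by exact hx) hc i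
  exact hψ j ((Pi.evalMonoidHom P j).map_isConj hj)

namespace FreeGroup

open scoped Classical

section Rewriting

/-- Rewriting of words along a cover of the rose: `φ` describes the monodromy, `σ i` is a word
labelling a path to the sheet `i`, and the edges closing up to trivial loops are collapsed. -/
noncomputable def rewriting {S Q : Type} [Group Q] (φ : FreeGroup S →* Q)
    (σ : Q → FreeGroup S) : FreeGroup S →* RegularWreathProduct (FreeGroup (S × Q)) Q :=
  lift fun t => ⟨fun i => if σ i * of t * (σ ((φ (of t))⁻¹ * i))⁻¹ = 1 then 1 else of (t, i),
    φ (of t)⟩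

variable {S Q : Type} [Group Q] (φ : FreeGroup S →* Q) (σ : Q → FreeGroup S)

theorem rewriting_right (w : FreeGroup S) : (rewriting φ σ w).right = φ w := by
  have : RegularWreathProduct.rightHom.comp (rewriting φ σ) = φ := by
    ext t
    simp [rewriting]
  exact DFunLike.congr_fun this w

theorem rewriting_inv_left (w : FreeGroup S) (i : Q) :
    (rewriting φ σ w⁻¹).left i = ((rewriting φ σ w).left (φ w * i))⁻¹ := by
  simp [rewriting_right]

/-- Reading a rewritten word in the original free group. -/
def unrewriting : FreeGroup (S × Q) →* FreeGroup S :=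
  lift fun e => σ e.2 * of e.1 * (σ ((φ (of e.1))⁻¹ * e.2))⁻¹

theorem unrewriting_rewriting (w : FreeGroup S) (i : Q) :
    unrewriting φ σ ((rewriting φ σ w).left i) = σ i * w * (σ ((φ w)⁻¹ * i))⁻¹ := by
  induction w using FreeGroup.induction_on generalizing i with
  | C1 => simp
  | of t =>
    simp only [rewriting, lift_apply_of]
    split_ifs with h
    · simp [h]
    · simp [unrewriting]
  | inv_of t ih =>
    have := ih (φ (of t) * i)
    rw [rewriting_inv_left, _root_.map_inv, _root_.map_inv, this]
    simp [mul_assoc]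
  | mul a b iha ihb =>
    simp only [_root_.map_mul, RegularWreathProduct.mul_left, Pi.mul_apply,
      rewriting_right, iha, ihb]
    simp [mul_assoc]

theorem isConj_of_isConj_rewriting {x y : FreeGroup S} (hx : φ x = 1) (hy : φ y = 1) {i j : Q}
    (h : IsConj ((rewriting φ σ x).left i) ((rewriting φ σ y).left j)) : IsConj x y := by
  have h' := (unrewriting φ σ).map_isConj h
  rw [unrewriting_rewriting, unrewriting_rewriting, hx, hy, inv_one, one_mul, one_mul] at h'
  exact (isConj_iff.2 ⟨σ i, rfl⟩).trans (h'.trans (isConj_iff.2 ⟨σ j, rfl⟩).symm)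

theorem norm_rewriting_of_le (t : S) (i : Q) : norm ((rewriting φ σ (of t)).left i) ≤ 1 := by
  simp only [rewriting, lift_apply_of]
  split_ifs <;> simp

theorem norm_rewriting_letter_le (e : S × Bool) (i : Q) :
    norm ((rewriting φ σ (mk [e])).left i) ≤ 1 := by
  obtain ⟨t, _ | _⟩ := e
  · have : mk [(t, false)] = (of t)⁻¹ := rfl
    rw [this, rewriting_inv_left, norm_inv_eq]
    exact norm_rewriting_of_le φ σ t _
  · exact norm_rewriting_of_le φ σ t i

theorem norm_rewriting_cons_le (e : S × Bool) (L : List (S × Bool)) (i : Q) :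
    norm ((rewriting φ σ (mk (e :: L))).left i) ≤ norm ((rewriting φ σ (mk [e])).left i) +
      norm ((rewriting φ σ (mk L)).left ((φ (mk [e]))⁻¹ * i)) := by
  have : mk (e :: L) = mk [e] * mk L := by simp [mul_mk]
  rw [this, _root_.map_mul, RegularWreathProduct.mul_left, Pi.mul_apply, rewriting_right]
  exact norm_mul_le _ _

theorem norm_rewriting_mk_le (L : List (S × Bool)) (i : Q) :
    norm ((rewriting φ σ (mk L)).left i) ≤ L.length := by
  induction L generalizing i with
  | nil => simp [← one_eq_mk]
  | cons e L ih =>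
    refine (norm_rewriting_cons_le φ σ e L i).trans ?_
    rw [List.length_cons, add_comm]
    exact add_le_add (ih _) (norm_rewriting_letter_le φ σ e i)

theorem exists_norm_rewriting_mk_lt {s : S} {k : Q}
    (hk : σ k * of s * (σ ((φ (of s))⁻¹ * k))⁻¹ = 1) {b : Bool} (L : List (S × Bool))
    (hL : (s, b) ∈ L) : ∃ i, norm ((rewriting φ σ (mk L)).left i) < L.length := by
  induction L with
  | nil => simp at hL
  | cons e L ih =>
    rw [List.mem_cons] at hL
    by_cases he : (s, b) = e
    · obtain ⟨i, hi⟩ : ∃ i, norm ((rewriting φ σ (mk [e])).left i) = 0 := by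
        subst he
        cases b
        · refine ⟨(φ (of s))⁻¹ * k, ?_⟩
          have : mk [(s, false)] = (of s)⁻¹ := rfl
          rw [this, rewriting_inv_left, norm_inv_eq, mul_inv_cancel_left]
          simp [rewriting, hk]
        · refine ⟨k, ?_⟩
          change norm ((rewriting φ σ (of s)).left k) = 0
          simp [rewriting, hk]
      refine ⟨i, (norm_rewriting_cons_le φ σ e L i).trans_lt ?_⟩
      rw [hi, List.length_cons, zero_add]
      exact Nat.lt_succ_of_le (norm_rewriting_mk_le φ σ L _)
    · obtain ⟨i, hi⟩ := ih (hL.resolve_left he)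
      refine ⟨φ (mk [e]) * i, (norm_rewriting_cons_le φ σ e L _).trans_lt ?_⟩
      rw [inv_mul_cancel_left, List.length_cons, add_comm L.length]
      exact add_lt_add_of_le_of_lt (norm_rewriting_letter_le φ σ e _) hi

end Rewriting

theorem exists_mk_eq_zpow {S : Type} (s : S) (L : List (S × Bool)) (h : ∀ e ∈ L, e.1 = s) :
    ∃ m : ℤ, mk L = of s ^ m := by
  induction L with
  | nil => exact ⟨0, by simp [one_eq_mk]⟩
  | cons e L ih =>
    obtain ⟨m, hm⟩ := ih fun e he => h e (List.mem_cons_of_mem _ he)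
    have he : mk (e :: L) = mk [e] * mk L := by simp [mul_mk]
    obtain ⟨t, b⟩ := e
    obtain rfl : t = s := h (t, b) List.mem_cons_self
    cases b
    · refine ⟨-1 + m, ?_⟩
      have : mk [(t, false)] = (of t)⁻¹ := rfl
      rw [he, hm, this, zpow_add, zpow_neg_one]
    · exact ⟨1 + m, by rw [he, hm, zpow_add, zpow_one]; rfl⟩

theorem pConjSeparated_zpow (p : ℕ) [hp : Fact p.Prime] {S : Type} (s : S) {m n : ℤ}
    (h : m ≠ n) : PConjSeparated p (of s ^ m) (of s ^ n) := by
  obtain ⟨k, hk⟩ : ∃ k : ℕ, (m - n).natAbs < p ^ k :=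
    ⟨_, Nat.lt_pow_self hp.out.one_lt⟩
  refine PConjSeparated.of_comm (isPGroup_multiplicative_zmod_pow p k)
    (lift fun _ => Multiplicative.ofAdd (1 : ZMod (p ^ k))) fun he => h ?_
  simp only [map_zpow, lift_apply_of, ← ofAdd_zsmul, zsmul_one] at he
  have he' : (m : ZMod (p ^ k)) = n := Multiplicative.ofAdd.injective he
  rw [← sub_eq_zero, ← Int.cast_sub, ZMod.intCast_zmod_eq_zero_iff_dvd] at he'
  have := Int.eq_zero_of_dvd_of_natAbs_lt_natAbs he' (by simpa using hk)
  exact sub_eq_zero.1 this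

/-- The exponent sum modulo `p`, with generators weighted by `c`. -/
def weight {p : ℕ} {S : Type} (c : S → ZMod p) : FreeGroup S →* Multiplicative (ZMod p) :=
  lift fun t => Multiplicative.ofAdd (c t)

theorem weight_sub_smul {p : ℕ} {S : Type} (c d : S → ZMod p) (r : ZMod p) (x : FreeGroup S) :
    (weight (c - r • d) x).toAdd = (weight c x).toAdd - r * (weight d x).toAdd := by
  induction x using FreeGroup.induction_on with
  | C1 => simp
  | of t => simp [weight]
  | inv_of t ih => simp only [_root_.map_inv, toAdd_inv, ih]; ring
  | mul a b iha ihb => simp only [_root_.map_mul, toAdd_mul, iha, ihb]; ring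

/-- The inductive step of the separation theorem, for a letter `s` of `y` on which some weight
killing `x` and `y` is non-trivial. -/
theorem pConjSeparated_step {p : ℕ} [hp : Fact p.Prime] {S : Type} {x y : FreeGroup S}
    (ih : ∀ (T : Type) (u v : FreeGroup T), norm u + norm v < norm x + norm y →
      ¬ IsConj u v → PConjSeparated p u v)
    (hxy : ¬ IsConj x y) (c : S → ZMod p) (hx : weight c x = 1) (hy : weight c y = 1)
    {s : S} (hs : c s = 1) {b : Bool} (hsy : (s, b) ∈ y.toWord) : PConjSeparated p x y := by
  let σ : Multiplicative (ZMod p) → FreeGroup S := fun i => (of s ^ i.toAdd.val)⁻¹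
  have hk : σ (Multiplicative.ofAdd 1) * of s *
      (σ ((weight c (of s))⁻¹ * Multiplicative.ofAdd 1))⁻¹ = 1 := by
    simp [σ, weight, hs, ZMod.val_one]
  obtain ⟨i, hi⟩ := exists_norm_rewriting_mk_lt (weight c) σ hk _ hsy
  rw [mk_toWord] at hi
  refine PConjSeparated.of_wreath (isPGroup_multiplicative_zmod p)
    (rewriting (weight c) σ) ((rewriting_right _ _ x).trans hx) i fun j => ih _ _ _ ?_ ?_
  · have := norm_rewriting_mk_le (weight c) σ x.toWord j
    rw [mk_toWord] at this
    convert! add_lt_add_of_le_of_lt this hi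
  · exact fun h => hxy (isConj_of_isConj_rewriting _ _ hx hy h)

/-- Free groups are conjugacy separable with respect to finite `p`-groups. -/
theorem pConjSeparated (p : ℕ) [hp : Fact p.Prime] {S : Type} {x y : FreeGroup S}
    (hxy : ¬ IsConj x y) : PConjSeparated p x y := by
  induction hn : norm x + norm y using Nat.strong_induction_on generalizing S with
  | _ n ih =>
  subst hn
  replace ih : ∀ (T : Type) (u v : FreeGroup T), norm u + norm v < norm x + norm y →
      ¬ IsConj u v → PConjSeparated p u v := fun T u v h huv => ih _ h huv rfl
  by_cases he : ∃ c : S → ZMod p, weight c x ≠ weight c y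
  · obtain ⟨c, hc⟩ := he
    exact PConjSeparated.of_comm (isPGroup_multiplicative_zmod p) _ hc
  push Not at he
  have step : ∀ (c : S → ZMod p) (s : S) (b : Bool), weight c x = 1 → c s = 1 →
      (s, b) ∈ x.toWord ++ y.toWord → PConjSeparated p x y := by
    intro c s b hc hs hmem
    rcases List.mem_append.1 hmem with hm | hm
    · refine (pConjSeparated_step (fun T u v h => ih T u v ?_) (fun h => hxy h.symm) c
        (he c ▸ hc) hc hs hm).symm
      rwa [add_comm (norm x)]
    · exact pConjSeparated_step ih hxy c hc (he c ▸ hc) hs hm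
  by_cases hL : ∃ d ∈ x.toWord ++ y.toWord, ∃ e ∈ x.toWord ++ y.toWord, d.1 ≠ e.1
  · obtain ⟨⟨s, b⟩, hs, ⟨t, b'⟩, ht, hst⟩ := hL
    by_cases h0 : (weight (Pi.single t (1 : ZMod p)) x).toAdd = 0
    · exact step _ t b' (toAdd_eq_zero.1 h0) (by simp) ht
    · refine step (Pi.single s 1 - ((weight (Pi.single s (1 : ZMod p)) x).toAdd /
        (weight (Pi.single t (1 : ZMod p)) x).toAdd) • Pi.single t 1) s b ?_ ?_ hs
      · rw [← toAdd_eq_zero, weight_sub_smul, div_mul_cancel₀ _ h0, sub_self]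
      · have : s ≠ t := hst
        simp [this]
  · push Not at hL
    rcases hw : x.toWord ++ y.toWord with _ | ⟨e, L⟩
    · rw [List.append_eq_nil_iff, toWord_eq_nil_iff, toWord_eq_nil_iff] at hw
      exact absurd (hw.1 ▸ hw.2 ▸ IsConj.refl _) hxy
    · have hs : ∀ d ∈ x.toWord ++ y.toWord, d.1 = e.1 := fun d hd => hL d hd e (by simp [hw])
      obtain ⟨m, hm⟩ := exists_mk_eq_zpow e.1 x.toWord fun d hd =>
        hs d (List.mem_append_left _ hd)
      obtain ⟨n, hn⟩ := exists_mk_eq_zpow e.1 y.toWord fun d hd =>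
        hs d (List.mem_append_right _ hd)
      rw [mk_toWord] at hm hn
      rw [hm, hn] at hxy ⊢
      exact pConjSeparated_zpow p e.1 fun h => hxy (h ▸ IsConj.refl _)

end FreeGroup

theorem IsPseudovariety.of_mulEquiv {C : GrpB → Prop} (hC : IsPseudovariety C) {G H : Type}
    [Group G] [Group H] (hG : C (GrpB.of G)) (e : H ≃* G) : C (GrpB.of H) :=
  hC.1 (GrpB.of G) (GrpB.of H) hG ⟨e⟩

theorem IsPseudovariety.exists_prime_zmod {C : GrpB → Prop} (hC : IsPseudovariety C)
    (hCnt : ClassNontrivial C) :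
    ∃ p : ℕ, p.Prime ∧ C (GrpB.of (Multiplicative (ZMod p))) := by
  obtain ⟨A, hA, a, ha⟩ := hCnt
  obtain h0 | hfin := eq_or_ne (orderOf a) 0
  · have hinj : Function.Injective (zpowersHom A.carrier a) :=
      injective_zpow_iff_not_isOfFinOrder.2 (orderOf_eq_zero_iff.1 h0)
    have hZ : C (GrpB.of (Multiplicative ℤ)) :=
      hC.of_mulEquiv (hC.2.1 A _ hA) (MonoidHom.ofInjective hinj)
    let f : Multiplicative ℤ →* Multiplicative (ZMod 2) :=
      (Int.castAddHom (ZMod 2)).toMultiplicative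
    have hf : Function.Surjective f := fun z =>
      (ZMod.intCast_surjective z.toAdd).imp fun _ h => h
    have hQ (N : Subgroup (Multiplicative ℤ)) [h : N.Normal] :
        C (GrpB.of (Multiplicative ℤ ⧸ N)) :=
      have hquot := hC.2.2.2
      @hquot (GrpB.of (Multiplicative ℤ)) N h hZ
    exact ⟨2, Nat.prime_two, hC.of_mulEquiv (hQ f.ker)
      (QuotientGroup.quotientKerEquivOfSurjective f hf).symm⟩
  · obtain ⟨p, hp, hdvd⟩ := Nat.exists_prime_and_dvd (mt orderOf_eq_one_iff.1 ha)
    have := Fact.mk hp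
    have ho : orderOf (a ^ (orderOf a / p)) = p := orderOf_pow_orderOf_div hfin hdvd
    refine ⟨p, hp, hC.of_mulEquiv (hC.2.1 A (Subgroup.zpowers (a ^ (orderOf a / p))) hA)
      (mulEquivOfPrimeCardEq (p := p) (by simp) ?_)⟩
    rw [Nat.card_zpowers, ho]

theorem IsPseudovariety.of_isPGroup {C : GrpB → Prop} (hC : IsPseudovariety C)
    (hCext : IsExtensionClosed C) {p : ℕ} [hp : Fact p.Prime]
    (hZ : C (GrpB.of (Multiplicative (ZMod p)))) {P : Type} [Group P] [Finite P]
    (hP : IsPGroup p P) : C (GrpB.of P) := by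
  induction hn : Nat.card P using Nat.strong_induction_on generalizing P with
  | _ n ih =>
  subst hn
  rcases subsingleton_or_nontrivial P with h | h
  · have : Unique P := uniqueOfSubsingleton 1
    exact hC.of_mulEquiv (hC.2.1 (GrpB.of (Multiplicative (ZMod p))) ⊥ hZ)
      (MulEquiv.ofUnique (M := P) (N := (⊥ : Subgroup (Multiplicative (ZMod p)))))
  · have hnt := hP.center_nontrivial
    have hd : p ∣ Nat.card (Subgroup.center P) := by
      obtain ⟨n, hn, h⟩ := (hP.to_subgroup (Subgroup.center P)).nontrivial_iff_card.1 hnt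
      exact h ▸ dvd_pow_self p hn.ne'
    obtain ⟨z, hz⟩ := exists_prime_orderOf_dvd_card' p hd
    have hz' : orderOf (z : P) = p := by rw [Subgroup.orderOf_coe, hz]
    have hN : (Subgroup.zpowers (z : P)).Normal :=
      ⟨fun n hn g => by
        have hc : n ∈ Subgroup.center P :=
          (Subgroup.zpowers_le (H := Subgroup.center P)).2 z.2 hn
        rwa [Subgroup.mem_center_iff.1 hc g, mul_inv_cancel_right]⟩
    have hcard : Nat.card (Subgroup.zpowers (z : P)) = p := by rw [Nat.card_zpowers, hz']
    refine @hCext (GrpB.of P) (Subgroup.zpowers (z : P)) hN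
      (hC.of_mulEquiv hZ (mulEquivOfPrimeCardEq (p := p) hcard (by simp)))
      (ih _ ?_ (P := P ⧸ Subgroup.zpowers (z : P)) (hP.to_quotient _) rfl)
    rw [Subgroup.card_eq_card_quotient_mul_card_subgroup (Subgroup.zpowers (z : P)), hcard]
    exact lt_mul_of_one_lt_right Nat.card_pos hp.out.one_lt

/-- Lemma 4.2: for a non-trivial extension-closed pseudovariety
`C`, every free group is `C`-hereditarily conjugacy separable. -/
theorem stmt9 (C : GrpB → Prop) (hC : IsPseudovariety C)
    (hCnt : ClassNontrivial C) (hCext : IsExtensionClosed C)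
    (F : Type) [Group F] (hF : IsFreeGroupType F) :
    HerConjSepC C F := by
  intro H _ x y hxy
  obtain ⟨p, hp, hZ⟩ := hC.exists_prime_zmod hCnt
  have := Fact.mk hp
  obtain ⟨S, ⟨e⟩⟩ := hF
  have : IsFreeGroup F := IsFreeGroup.ofMulEquiv e.symm
  have hxy' : ¬ IsConj (IsFreeGroup.toFreeGroup H x) (IsFreeGroup.toFreeGroup H y) := fun h =>
    hxy (by simpa using (IsFreeGroup.toFreeGroup H).symm.toMonoidHom.map_isConj h)
  obtain ⟨P, _, _, hP, φ, hφ⟩ := FreeGroup.pConjSeparated p hxy'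
  exact ⟨GrpB.of P, hC.of_isPGroup hCext hZ hP,
    φ.comp (IsFreeGroup.toFreeGroup H).toMonoidHom, hφ⟩
end

section
/- Let 𝒞 be an extension-closed pseudovariety of finite groups. Let F₁ and F₂ be 𝒞-hereditarily conjugacy separable groups with cyclic centralizers, let G ≤ F₁ × F₂ be a subdirect product, and let N₁ := G ∩ F₁. If the quotient F₁/N₁ is cyclic subgroup 𝒞-separable, then G is 𝒞-conjugacy separable. -/
section CoC

variable {C : GrpB → Prop} {F Q : Type} [Group F] [Group Q]

/-- The co-`C` subgroups are the kernels of homomorphisms to members of `C`. -/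
theorem isCoC_iff_exists_ker (hC : IsPseudovariety C) {N : Subgroup F} :
    IsCoC C N ↔ ∃ M : GrpB, C M ∧ ∃ φ : F →* M.carrier, φ.ker = N := by
  constructor
  · rintro ⟨hn, h⟩
    exact ⟨_, h, QuotientGroup.mk' N, QuotientGroup.ker_mk' N⟩
  · rintro ⟨M, hM, φ, rfl⟩
    exact ⟨inferInstance,
      hC.1 _ _ (hC.2.1 M φ.range hM) ⟨QuotientGroup.quotientKerEquivRange φ⟩⟩

theorem IsCoC.top (hC : IsPseudovariety C) {M : GrpB} (hM : C M) :
    IsCoC C (⊤ : Subgroup F) :=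
  (isCoC_iff_exists_ker hC).2 ⟨M, hM, 1, MonoidHom.ker_one⟩

theorem IsCoC.inf (hC : IsPseudovariety C) {N K : Subgroup F} (hN : IsCoC C N)
    (hK : IsCoC C K) : IsCoC C (N ⊓ K) := by
  obtain ⟨A, hA, φ, rfl⟩ := (isCoC_iff_exists_ker hC).1 hN
  obtain ⟨B, hB, ψ, rfl⟩ := (isCoC_iff_exists_ker hC).1 hK
  exact (isCoC_iff_exists_ker hC).2 ⟨_, hC.2.2.1 A B hA hB, φ.prod ψ, MonoidHom.ker_prod φ ψ⟩

theorem IsCoC.comap (hC : IsPseudovariety C) {N : Subgroup Q} (hN : IsCoC C N)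
    (f : F →* Q) : IsCoC C (N.comap f) := by
  obtain ⟨A, hA, φ, rfl⟩ := (isCoC_iff_exists_ker hC).1 hN
  exact (isCoC_iff_exists_ker hC).2 ⟨A, hA, φ.comp f, (MonoidHom.comap_ker φ f).symm⟩

theorem IsCoC.iInf (hC : IsPseudovariety C) {M : GrpB} (hM : C M) {ι : Type*} [Finite ι]
    {N : ι → Subgroup F} (hN : ∀ i, IsCoC C (N i)) : IsCoC C (⨅ i, N i) := by
  have := Fintype.ofFinite ι
  rw [← Finset.inf_univ_eq_iInf]
  exact Finset.inf_induction (IsCoC.top hC hM) (fun _ h₁ _ h₂ => IsCoC.inf hC h₁ h₂)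
    fun i _ => hN i

/-- Extension-closedness, phrased for co-`C` subgroups. -/
theorem IsCoC.of_subgroupOf (hC : IsPseudovariety C) (hCext : IsExtensionClosed C)
    {K N : Subgroup F} [hn : N.Normal] (hNK : N ≤ K) (hK : IsCoC C K)
    (h : IsCoC C (N.subgroupOf K)) : IsCoC C N := by
  obtain ⟨hKn, hK⟩ := hK
  obtain ⟨_, h⟩ := h
  refine ⟨hn, ?_⟩
  have hker : ((QuotientGroup.mk' N).subgroupMap K).ker = N.subgroupOf K := by
    ext x
    simp [MonoidHom.mem_ker, Subtype.ext_iff, Subgroup.mem_subgroupOf]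
  have : (K.map (QuotientGroup.mk' N)).Normal := hKn.map _ (QuotientGroup.mk'_surjective N)
  refine @hCext (GrpB.of (F ⧸ N)) (K.map (QuotientGroup.mk' N)) this ?_ ?_
  · exact hC.1 _ _ h ⟨((QuotientGroup.quotientMulEquivOfEq hker.symm).trans
      (QuotientGroup.quotientKerEquivOfSurjective _
        (MonoidHom.subgroupMap_surjective (QuotientGroup.mk' N) K))).symm⟩
  · exact hC.1 _ _ hK ⟨QuotientGroup.quotientQuotientEquivQuotient N K hNK⟩

theorem IsCoC.normalCore (hC : IsPseudovariety C) (hCfin : ClassOfFiniteGroups C)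
    (hCext : IsExtensionClosed C) {K P : Subgroup F} (hPK : P ≤ K) (hK : IsCoC C K)
    (hP : IsCoC C (P.subgroupOf K)) : IsCoC C P.normalCore := by
  refine IsCoC.of_subgroupOf hC hCext (P.normalCore_le.trans hPK) hK ?_
  obtain ⟨hKn, hKC⟩ := hK
  have : Finite (F ⧸ K) := hCfin _ hKC
  have hcore : P.normalCore.subgroupOf K = ⨅ q : F ⧸ K,
      (P.subgroupOf K).comap (MulAut.conjNormal (H := K) q.out⁻¹).toMonoidHom := by
    ext k
    simp only [Subgroup.mem_subgroupOf, Subgroup.mem_iInf, Subgroup.mem_comap]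
    constructor
    · intro h q
      simpa using h q.out⁻¹
    · intro h b
      obtain ⟨l, hl⟩ := QuotientGroup.mk_out_eq_mul K b⁻¹
      have := hP.1.conj_mem _ (Subgroup.mem_subgroupOf.2 (h (b⁻¹ : F))) l
      rw [hl] at this
      simpa [Subgroup.mem_subgroupOf, mul_assoc] using this
  rw [hcore]
  exact IsCoC.iInf hC hKC fun q => hP.comap hC _

theorem COpen.exists_isCoC (hC : IsPseudovariety C) {M : GrpB} (hM : C M) {U : Set F}
    (hU : COpen C U) {x : F} (hx : x ∈ U) :
    ∃ N : Subgroup F, IsCoC C N ∧ ∀ y, x⁻¹ * y ∈ N → y ∈ U := by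
  induction hU with
  | basic s hs =>
    obtain ⟨N, hN, g, rfl⟩ := hs
    refine ⟨N, hN, fun y hy => ?_⟩
    simpa [mul_assoc] using mul_mem hx hy
  | univ => exact ⟨⊤, IsCoC.top hC hM, fun y _ => Set.mem_univ y⟩
  | inter s t _ _ hs ht =>
    obtain ⟨N, hN, hNs⟩ := hs hx.1
    obtain ⟨K, hK, hKt⟩ := ht hx.2
    exact ⟨N ⊓ K, hN.inf hC hK, fun y hy => ⟨hNs y hy.1, hKt y hy.2⟩⟩
  | sUnion S _ ih =>
    obtain ⟨s, hs, hxs⟩ := hx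
    obtain ⟨N, hN, h⟩ := ih s hs hxs
    exact ⟨N, hN, fun y hy => ⟨s, hs, h y hy⟩⟩

theorem IsCoC.cOpen_of_le {K H : Subgroup F} (hK : IsCoC C K) (hKH : K ≤ H) :
    COpen C (H : Set F) := by
  have hH : (H : Set F) = ⋃ g : H, {x : F | (g : F)⁻¹ * x ∈ K} := by
    ext x
    simp only [SetLike.mem_coe, Set.mem_iUnion, Set.mem_ofPred_eq]
    refine ⟨fun hx => ⟨⟨x, hx⟩, by simp⟩, fun ⟨g, hg⟩ => ?_⟩
    simpa using mul_mem g.2 (hKH hg)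
  rw [hH]
  exact @isOpen_iUnion _ _ (ProCTop C F) _ fun g =>
    TopologicalSpace.isOpen_generateFrom_of_mem ⟨K, hK, g, rfl⟩

theorem HerConjSepC.conjSepC (h : HerConjSepC C F) : ConjSepC C F := by
  intro x y hxy
  have htop : COpen C ((⊤ : Subgroup F) : Set F) := @isOpen_univ F (ProCTop C F)
  obtain ⟨M, hM, φ, hφ⟩ := h ⊤ htop ⟨x, trivial⟩ ⟨y, trivial⟩ fun hc =>
    hxy ((⊤ : Subgroup F).subtype.map_isConj hc)
  exact ⟨M, hM, φ.comp (Subgroup.topEquiv (G := F)).symm.toMonoidHom, hφ⟩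

/-- For a fixed `z ∉ C_F(x) K`, some co-`C` subgroup prevents every element of `K z` from
commuting with `x` modulo it. -/
theorem HerConjSepC.exists_isCoC_coset (hC : IsPseudovariety C)
    (hCfin : ClassOfFiniteGroups C) (hCext : IsExtensionClosed C) (h : HerConjSepC C F)
    {K : Subgroup F} (hK : IsCoC C K) (x z : F)
    (hz : ∀ k ∈ K, ¬ Commute (k * z) x) :
    ∃ L : Subgroup F, IsCoC C L ∧ ∀ k ∈ K, x⁻¹ * ((k * z) * x * (k * z)⁻¹) ∉ L := by
  obtain ⟨hKn, hKC⟩ := id hK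
  by_cases hzx : x⁻¹ * (z * x * z⁻¹) ∈ K
  · set H : Subgroup F := K ⊔ Subgroup.zpowers x
    have hKH : K ≤ H := le_sup_left
    have hxH : x ∈ H := le_sup_right (a := K) (Subgroup.mem_zpowers x)
    have hzH : z * x * z⁻¹ ∈ H := by simpa using mul_mem hxH (hKH hzx)
    obtain ⟨M, hM, φ, hφ⟩ := h H (hK.cOpen_of_le hKH) ⟨x, hxH⟩ ⟨_, hzH⟩ fun hc => by
      obtain ⟨⟨c, hc⟩, hcz⟩ := isConj_iff.1 hc
      obtain ⟨k, hk, y, ⟨n, rfl⟩, rfl⟩ := Subgroup.mem_sup_of_normal_left.1 hc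
      have hcz : k * x ^ n * x * (k * x ^ n)⁻¹ = z * x * z⁻¹ := congrArg Subtype.val hcz
      have hkx : k * x * k⁻¹ = z * x * z⁻¹ := by
        rw [← hcz]
        group
      refine hz k⁻¹ (inv_mem hk) ?_
      calc k⁻¹ * z * x = k⁻¹ * (z * x * z⁻¹) * z := by group
        _ = x * (k⁻¹ * z) := by rw [← hkx]; group
    let P : Subgroup F := φ.ker.map H.subtype ⊓ K
    have hP : P.subgroupOf K = (φ.comp (Subgroup.inclusion hKH)).ker := by
      ext k
      simp only [P, Subgroup.mem_subgroupOf, Subgroup.mem_inf, Subgroup.mem_map, MonoidHom.mem_ker,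
        MonoidHom.comp_apply]
      constructor
      · rintro ⟨⟨y, hy, hyk⟩, -⟩
        rw [← hy]
        exact congrArg φ (Subtype.ext hyk.symm)
      · exact fun hk => ⟨⟨_, hk, rfl⟩, k.2⟩
    refine ⟨P.normalCore, IsCoC.normalCore hC hCfin hCext inf_le_right hK
      (hP ▸ (isCoC_iff_exists_ker hC).2 ⟨M, hM, _, rfl⟩), fun k hk hL => hφ ?_⟩
    obtain ⟨⟨y, hy, hyk⟩, -⟩ := P.normalCore_le hL
    refine isConj_iff.2 ⟨φ ⟨k, hKH hk⟩⁻¹, ?_⟩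
    have hy1 : φ y = 1 := hy
    have hyk : (y : F) = x⁻¹ * (k * z * x * (k * z)⁻¹) := hyk
    have hprod : (⟨z * x * z⁻¹, hzH⟩ : H) =
        ⟨k, hKH hk⟩⁻¹ * (⟨x, hxH⟩ * y) * ⟨k, hKH hk⟩⁻¹⁻¹ := by
      apply Subtype.ext
      simp only [Subgroup.coe_mul, Subgroup.coe_inv, hyk]
      group
    rw [hprod]
    simp [hy1]
  · refine ⟨K, hK, fun k hk hkz => hzx ?_⟩
    have h₁ := hKn.conj_mem _ (inv_mem hk) x⁻¹
    convert mul_mem (mul_mem h₁ hkz) hk using 1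
    group

/-- The centralizer condition: modulo a small enough co-`C` subgroup `L`, the centralizer of `x`
lies in the image of `K C_F(x)`. -/
theorem HerConjSepC.exists_isCoC_centralizer (hC : IsPseudovariety C)
    (hCfin : ClassOfFiniteGroups C) (hCext : IsExtensionClosed C) (h : HerConjSepC C F)
    {K : Subgroup F} (hK : IsCoC C K) (x : F) :
    ∃ L : Subgroup F, IsCoC C L ∧
      ∀ y, x⁻¹ * (y * x * y⁻¹) ∈ L → ∃ k ∈ K, Commute (k * y) x := by
  obtain ⟨hKn, hKC⟩ := id hK
  have : Finite (F ⧸ K) := hCfin _ hKC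
  have hcoset (z : F) : ∃ L : Subgroup F, IsCoC C L ∧ ((∀ k ∈ K, ¬ Commute (k * z) x) →
      ∀ k ∈ K, x⁻¹ * ((k * z) * x * (k * z)⁻¹) ∉ L) := by
    by_cases hz : ∀ k ∈ K, ¬ Commute (k * z) x
    · obtain ⟨L, hL, hLz⟩ := h.exists_isCoC_coset hC hCfin hCext hK x z hz
      exact ⟨L, hL, fun _ => hLz⟩
    · exact ⟨K, hK, fun h => absurd h hz⟩
  choose L hL hLz using hcoset
  refine ⟨⨅ q : F ⧸ K, L q.out,
    IsCoC.iInf hC hKC fun q => hL _, fun y hy => ?_⟩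
  by_contra! hno
  obtain ⟨l, hl⟩ := QuotientGroup.mk_out_eq_mul K y
  have hlK : y * (l : F) * y⁻¹ ∈ K := hKn.conj_mem _ l.2 y
  refine hLz (y : F ⧸ K).out (fun k hk => ?_) (y * (l : F) * y⁻¹)⁻¹ (inv_mem hlK) ?_
  · have := hno _ (mul_mem hk hlK)
    rw [hl]
    convert this using 1
    group
  · have := Subgroup.mem_iInf.1 hy (y : F ⧸ K)
    convert this using 2
    rw [hl]
    group

/-- If a nonzero power of `a` lies in the `C`-closed subgroup `⟨b⟩`, then `⟨b⟩⟨a⟩` is `C`-closed. -/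
theorem exists_isCoC_notMem_zpowers_mul_zpowers (hC : IsPseudovariety C) {M : GrpB} (hM : C M)
    {a b q : Q} {m : ℤ} (hm : m ≠ 0) (ham : a ^ m ∈ Subgroup.zpowers b)
    (hb : CClosed C (Subgroup.zpowers b : Set Q)) (hq : ∀ s t : ℤ, q ≠ b ^ s * a ^ t) :
    ∃ K : Subgroup Q, IsCoC C K ∧ ∀ k ∈ K, ∀ s t : ℤ, q ≠ b ^ s * a ^ t * k := by
  have hclosed (i : ℕ) : ∃ K : Subgroup Q, IsCoC C K ∧
      ∀ y, (q * (a ^ i)⁻¹)⁻¹ * y ∈ K → y ∉ Subgroup.zpowers b := by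
    refine COpen.exists_isCoC hC hM (U := (Subgroup.zpowers b : Set Q)ᶜ)
      (@IsClosed.isOpen_compl _ (ProCTop C Q) _ hb) ?_
    rintro ⟨s, hs⟩
    refine hq s i ?_
    have hs : b ^ s = q * (a ^ i)⁻¹ := hs
    simp [hs]
  choose K hK hKb using hclosed
  have hinf := IsCoC.iInf hC hM fun i : Fin m.natAbs => hK i
  refine ⟨_, hinf, fun k hk s t hqk => ?_⟩
  obtain ⟨n, hn⟩ := ham
  have hn : b ^ n = a ^ m := hn
  obtain ⟨i, hi⟩ := Int.eq_ofNat_of_zero_le (Int.emod_nonneg t hm)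
  have him : i < m.natAbs := by
    have := Int.emod_lt_abs t hm
    rw [Int.abs_eq_natAbs] at this
    omega
  have hat : a ^ t = b ^ (n * (t / m)) * a ^ i := by
    rw [zpow_mul, hn, ← zpow_mul, ← zpow_natCast, ← hi, ← zpow_add, Int.mul_ediv_add_emod]
  refine hKb i (b ^ (s + n * (t / m))) ?_ ⟨_, rfl⟩
  have := inv_mem ((hK i).1.conj_mem _ (Subgroup.mem_iInf.1 hk ⟨i, him⟩) (a ^ i))
  convert this using 1
  rw [hqk, hat, zpow_add]
  group

end CoC

theorem HasCyclicCentralizers.exists_generator {F : Type} [Group F]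
    (h : HasCyclicCentralizers F) {x : F} (hx : x ≠ 1) :
    ∃ c : F, Commute c x ∧ (∀ y, Commute y x → ∃ n : ℤ, y = c ^ n) ∧
      ∃ m : ℤ, m ≠ 0 ∧ c ^ m = x := by
  obtain ⟨⟨c, hc⟩, hgen⟩ := (h x hx).exists_generator
  have hall (y : F) (hy : Commute y x) : ∃ n : ℤ, y = c ^ n := by
    obtain ⟨n, hn⟩ := hgen ⟨y, Subgroup.mem_centralizer_singleton_iff.2 hy⟩
    exact ⟨n, (congrArg Subtype.val hn).symm⟩
  obtain ⟨m, hm⟩ := hall x (Commute.refl x)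
  refine ⟨c, Subgroup.mem_centralizer_singleton_iff.1 hc, hall, m, ?_, hm.symm⟩
  rintro rfl
  exact hx (by simpa using hm)

theorem Commute.mul_conj_eq {F : Type*} [Group F] {c x : F} (h : Commute c x) (u : F) :
    u * c * x * (u * c)⁻¹ = u * x * u⁻¹ := by
  rw [mul_assoc u c x, h.eq]
  group

theorem inv_mul_conj_mem_ker {F M : Type*} [Group F] [Group M] {φ : F →* M} {a u x : F}
    (h : φ a * φ x * (φ a)⁻¹ = φ (u * x * u⁻¹)) :
    x⁻¹ * ((u⁻¹ * a) * x * (u⁻¹ * a)⁻¹) ∈ φ.ker := by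
  have hconj : (u⁻¹ * a) * x * (u⁻¹ * a)⁻¹ = u⁻¹ * (a * x * a⁻¹) * u := by group
  rw [MonoidHom.mem_ker, hconj]
  simp only [map_mul, map_inv] at h ⊢
  rw [h]
  group

/-- A subdirect product is the fibre product over `F₁ ⧸ N₁`. -/
theorem IsSubdirect.exists_fiber_hom {F₁ F₂ : Type} [Group F₁] [Group F₂]
    {G : Subgroup (F₁ × F₂)} (hG : IsSubdirect G) {N₁ : Subgroup F₁}
    (hN₁ : N₁ = Subgroup.comap (MonoidHom.inl F₁ F₂) G) [N₁.Normal] :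
    ∃ π : F₂ →* F₁ ⧸ N₁, ∀ a b, (a, b) ∈ G ↔ π b = a := by
  have hmem (n : F₁) : n ∈ N₁ ↔ (n, 1) ∈ G := by
    rw [hN₁]
    rfl
  have hsurj : Function.Surjective ((MonoidHom.snd F₁ F₂).comp G.subtype) := fun b => by
    obtain ⟨x, hx, rfl⟩ : b ∈ Subgroup.map (MonoidHom.snd F₁ F₂) G := hG.2 ▸ trivial
    exact ⟨⟨x, hx⟩, rfl⟩
  let p : G →* F₁ ⧸ N₁ := (QuotientGroup.mk' N₁).comp ((MonoidHom.fst F₁ F₂).comp G.subtype)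
  have hker : ((MonoidHom.snd F₁ F₂).comp G.subtype).ker ≤ p.ker := by
    rintro ⟨⟨a, b⟩, hab⟩ hb
    obtain rfl : b = 1 := hb
    exact (QuotientGroup.eq_one_iff a).2 ((hmem a).2 hab)
  let π := MonoidHom.liftOfSurjective _ hsurj ⟨p, hker⟩
  have hπ (a b) (hab : (a, b) ∈ G) : π b = a :=
    MonoidHom.liftOfRightInverse_comp_apply _ _ (Function.rightInverse_surjInv hsurj) ⟨p, hker⟩
      ⟨(a, b), hab⟩
  refine ⟨π, fun a b => ⟨hπ a b, fun h => ?_⟩⟩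
  obtain ⟨⟨⟨a', b'⟩, hab⟩, hb⟩ := hsurj b
  obtain rfl : b' = b := hb
  have := (hmem _).1 (QuotientGroup.eq.1 ((hπ _ _ hab).symm.trans h))
  simpa using mul_mem hab this

/-- Proposition 4.4: sufficient criterion for `C`-conjugacy
separability of a subdirect product of `C`-hereditarily conjugacy separable
groups with cyclic centralizers. -/
theorem stmt10 (C : GrpB → Prop) (hC : IsPseudovariety C)
    (hCfin : ClassOfFiniteGroups C) (hCext : IsExtensionClosed C)
    (F₁ F₂ : Type) [Group F₁] [Group F₂]
    (hher₁ : HerConjSepC C F₁) (hher₂ : HerConjSepC C F₂)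
    (hcyc₁ : HasCyclicCentralizers F₁) (hcyc₂ : HasCyclicCentralizers F₂)
    (G : Subgroup (F₁ × F₂)) (hG : IsSubdirect G)
    (N₁ : Subgroup F₁) (hN₁ : N₁ = Subgroup.comap (MonoidHom.inl F₁ F₂) G) [N₁.Normal]
    (hsep : CyclicSubgroupSepC C (F₁ ⧸ N₁)) :
    ConjSepC C ↥G := by
  obtain ⟨π, hπ⟩ := hG.exists_fiber_hom hN₁
  have hfst (a : F₁) : ∃ b, (a, b) ∈ G := by
    obtain ⟨⟨a, b⟩, hx, rfl⟩ : a ∈ Subgroup.map (MonoidHom.fst F₁ F₂) G := hG.1 ▸ trivial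
    exact ⟨b, hx⟩
  have hsnd (b : F₂) : ∃ a, (a, b) ∈ G := by
    obtain ⟨⟨a, b⟩, hx, rfl⟩ : b ∈ Subgroup.map (MonoidHom.snd F₁ F₂) G := hG.2 ▸ trivial
    exact ⟨a, hx⟩
  rintro ⟨⟨g₁, g₂⟩, hg⟩ ⟨⟨h₁, h₂⟩, hh⟩ hgh
  have hconj (a b) (hab : (a, b) ∈ G) (ha : a * g₁ * a⁻¹ = h₁) (hb : b * g₂ * b⁻¹ = h₂) :
      False :=
    hgh (isConj_iff.2 ⟨⟨(a, b), hab⟩, Subtype.ext (Prod.ext ha hb)⟩)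
  by_cases hc₁ : IsConj g₁ h₁
  swap
  · obtain ⟨M, hM, φ, hφ⟩ := hher₁.conjSepC _ _ hc₁
    exact ⟨M, hM, φ.comp ((MonoidHom.fst F₁ F₂).comp G.subtype), hφ⟩
  by_cases hc₂ : IsConj g₂ h₂
  swap
  · obtain ⟨M, hM, φ, hφ⟩ := hher₂.conjSepC _ _ hc₂
    exact ⟨M, hM, φ.comp ((MonoidHom.snd F₁ F₂).comp G.subtype), hφ⟩
  obtain ⟨u, rfl⟩ := isConj_iff.1 hc₁
  obtain ⟨v, rfl⟩ := isConj_iff.1 hc₂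
  have hg₁ : g₁ ≠ 1 := by
    rintro rfl
    obtain ⟨a, ha⟩ := hsnd v
    exact hconj a v ha (by simp) rfl
  have hg₂ : g₂ ≠ 1 := by
    rintro rfl
    obtain ⟨b, hb⟩ := hfst u
    exact hconj u b hb rfl (by simp)
  obtain ⟨M, hM, -⟩ := hher₁.conjSepC g₁ 1 fun h => hg₁ (isConj_one_left.1 h)
  obtain ⟨c₁, hc₁g, hgen₁, m₁, hm₁, hcm₁⟩ := hcyc₁.exists_generator hg₁
  obtain ⟨c₂, hc₂g, hgen₂, m₂, -, hcm₂⟩ := hcyc₂.exists_generator hg₂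
  have hpow : (c₁ : F₁ ⧸ N₁) ^ m₁ ∈ Subgroup.zpowers (π c₂) :=
    ⟨m₂, by
      change π c₂ ^ m₂ = _
      rw [← map_zpow, hcm₂, (hπ _ _).1 hg, ← hcm₁, QuotientGroup.mk_zpow]⟩
  obtain ⟨K, hK, hKq⟩ := exists_isCoC_notMem_zpowers_mul_zpowers hC hM hm₁ hpow (hsep _)
    (q := (π v)⁻¹ * u) fun s t hst => by
      refine hconj (u * c₁ ^ (-t)) (v * c₂ ^ s) ((hπ _ _).2 ?_) ?_ ?_
      · rw [map_mul, map_zpow, QuotientGroup.mk_mul, QuotientGroup.mk_zpow, zpow_neg,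
          eq_mul_inv_iff_mul_eq, mul_assoc, ← hst]
        group
      · exact (hc₁g.zpow_left (-t)).mul_conj_eq u
      · exact (hc₂g.zpow_left s).mul_conj_eq v
  obtain ⟨L₁, hL₁, hLc₁⟩ := hher₁.exists_isCoC_centralizer hC hCfin hCext
    (hK.comap hC (QuotientGroup.mk' N₁)) g₁
  obtain ⟨L₂, hL₂, hLc₂⟩ := hher₂.exists_isCoC_centralizer hC hCfin hCext (hK.comap hC π) g₂
  obtain ⟨A, hA, φ, rfl⟩ := (isCoC_iff_exists_ker hC).1 hL₁
  obtain ⟨B, hB, ψ, rfl⟩ := (isCoC_iff_exists_ker hC).1 hL₂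
  let Φ : G →* A.carrier × B.carrier := (φ.prodMap ψ).comp G.subtype
  refine ⟨GrpB.of Φ.range, hC.2.1 (GrpB.of (A.carrier × B.carrier)) _ (hC.2.2.1 A B hA hB),
    Φ.rangeRestrict, fun hc => ?_⟩
  obtain ⟨⟨_, ⟨⟨⟨a, b⟩, hab⟩, rfl⟩⟩, hc⟩ := isConj_iff.1 hc
  have hc : Φ _ * Φ _ * (Φ _)⁻¹ = Φ _ := congrArg Subtype.val hc
  have hφ : φ a * φ g₁ * (φ a)⁻¹ = φ (u * g₁ * u⁻¹) := congrArg Prod.fst hc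
  have hψ : ψ b * ψ g₂ * (ψ b)⁻¹ = ψ (v * g₂ * v⁻¹) := congrArg Prod.snd hc
  obtain ⟨k₁, hk₁, hcomm₁⟩ := hLc₁ _ (inv_mul_conj_mem_ker hφ)
  obtain ⟨k₂, hk₂, hcomm₂⟩ := hLc₂ _ (inv_mul_conj_mem_ker hψ)
  obtain ⟨t, ht⟩ := hgen₁ _ hcomm₁
  obtain ⟨s, hs⟩ := hgen₂ _ hcomm₂
  have hk₁ : (k₁ : F₁ ⧸ N₁) ∈ K := hk₁
  have hk₂ : π k₂ ∈ K := hk₂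
  have ht : (k₁ : F₁ ⧸ N₁) * ((u : F₁ ⧸ N₁)⁻¹ * a) = (c₁ : F₁ ⧸ N₁) ^ t :=
    congrArg (QuotientGroup.mk' N₁) ht
  have hs : π k₂ * ((π v)⁻¹ * π b) = π c₂ ^ s := by
    simpa using congrArg π hs
  rw [(hπ _ _).1 hab] at hs
  refine hKq _ (mul_mem (hK.1.conj_mem _ (inv_mem hk₂) (π c₂ ^ s * (c₁ : F₁ ⧸ N₁) ^ (-t))⁻¹) hk₁)
    s (-t) ?_
  rw [zpow_neg, ← hs, ← ht]
  group
end

section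
/- Let 𝒞 be a pseudovariety of groups, let G ≤ F₁ × F₂ be a subdirect product of groups F₁ and F₂, and let Nᵢ := G ∩ Fᵢ for i = 1, 2. Suppose that F₁/N₁ is not residually-𝒞 and that there exist elements h₁ ∈ N₁ and h₂ ∈ N₂ with C_{F₁}(h₁) ⊆ N₁ and C_{F₂}(h₂) ⊆ N₂. Then G is not 𝒞-conjugacy separable. -/
/-- If `p` dies in every `C`-quotient of `P` and `g` lifts `p` along a surjection `π : G →* P`, then
every homomorphism `φ` from `G` to a `C`-group sends `g` into the image of `ker π`. -/
theorem IsPseudovariety.exists_mem_ker_map_eq {C : GrpB → Prop} (hC : IsPseudovariety C)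
    {G P : Type} [Group G] [Group P] (π : G →* P) (hπ : Function.Surjective π) (g : G)
    (hg : ∀ M : GrpB, C M → ∀ ψ : P →* M.carrier, ψ (π g) = 1)
    (M : GrpB) (hM : C M) (φ : G →* M.carrier) : ∃ k ∈ π.ker, φ k = φ g := by
  obtain ⟨-, hsub, -, hquot⟩ := hC
  have hLn : (π.ker.map φ.rangeRestrict).Normal :=
    π.normal_ker.map _ φ.rangeRestrict_surjective
  let ψ : G →* φ.range ⧸ π.ker.map φ.rangeRestrict :=
    (QuotientGroup.mk' (π.ker.map φ.rangeRestrict)).comp φ.rangeRestrict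
  have hψ : π.ker ≤ ψ.ker := fun k hk =>
    (QuotientGroup.eq_one_iff _).2 (Subgroup.mem_map_of_mem φ.rangeRestrict hk)
  have hq : C (GrpB.of (φ.range ⧸ π.ker.map φ.rangeRestrict)) :=
    @hquot (GrpB.of φ.range) (π.ker.map φ.rangeRestrict) hLn (hsub M φ.range hM)
  have h1 : π.liftOfSurjective hπ ⟨ψ, hψ⟩ (π g) = 1 := hg _ hq (π.liftOfSurjective hπ ⟨ψ, hψ⟩)
  rw [MonoidHom.liftOfSurjective, MonoidHom.liftOfRightInverse_comp_apply] at h1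
  obtain ⟨k, hk, hkg⟩ := (QuotientGroup.eq_one_iff _).1 h1
  exact ⟨k, hk, congrArg Subtype.val hkg⟩

/-- Theorem 4.8: if `F₁/N₁` is not residually-`C` and there
are `h₁ ∈ N₁`, `h₂ ∈ N₂` whose centralizers are contained in `N₁`, `N₂`
respectively, then the subdirect product `G` is not `C`-conjugacy separable. -/
theorem stmt13 (C : GrpB → Prop) (hC : IsPseudovariety C)
    (F₁ F₂ : Type) [Group F₁] [Group F₂]
    (G : Subgroup (F₁ × F₂)) (hG : IsSubdirect G)
    (N₁ : Subgroup F₁) (hN₁ : N₁ = Subgroup.comap (MonoidHom.inl F₁ F₂) G) [N₁.Normal]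
    (N₂ : Subgroup F₂) (hN₂ : N₂ = Subgroup.comap (MonoidHom.inr F₁ F₂) G)
    (hres : ¬ ResiduallyC C (F₁ ⧸ N₁))
    (h₁ : F₁) (hh₁ : h₁ ∈ N₁) (hc₁ : Subgroup.centralizer ({h₁} : Set F₁) ≤ N₁)
    (h₂ : F₂) (hh₂ : h₂ ∈ N₂) (hc₂ : Subgroup.centralizer ({h₂} : Set F₂) ≤ N₂) :
    ¬ ConjSepC C ↥G := by
  intro hsep
  simp only [ResiduallyC, not_forall, not_exists, not_and, not_not] at hres
  obtain ⟨p, hp, hp'⟩ := hres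
  have mem₁ : ∀ {a : F₁}, a ∈ N₁ ↔ (a, (1 : F₂)) ∈ G := by
    intro a; rw [hN₁]; rfl
  have mem₂ : ∀ {b : F₂}, b ∈ N₂ ↔ ((1 : F₁), b) ∈ G := by
    intro b; rw [hN₂]; rfl
  let π : G →* F₁ ⧸ N₁ := (QuotientGroup.mk' N₁).comp ((MonoidHom.fst F₁ F₂).comp G.subtype)
  have hπ : Function.Surjective π := by
    intro q
    obtain ⟨a, rfl⟩ := QuotientGroup.mk'_surjective N₁ q
    obtain ⟨g, hg, rfl⟩ : a ∈ Subgroup.map (MonoidHom.fst F₁ F₂) G := hG.1 ▸ Subgroup.mem_top a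
    exact ⟨⟨g, hg⟩, rfl⟩
  obtain ⟨g, rfl⟩ := hπ p
  have hgN : g.1.1 ∉ N₁ := fun h => hp ((QuotientGroup.eq_one_iff _).2 h)
  let u : G := ⟨(h₁, 1), mem₁.1 hh₁⟩
  let v : G := ⟨(1, h₂), mem₂.1 hh₂⟩
  have hnc : ¬ IsConj (u * v) (g * u * g⁻¹ * v) := by
    rw [isConj_iff]
    rintro ⟨c, hc⟩
    have e₁ : c.1.1 * h₁ * c.1.1⁻¹ = g.1.1 * h₁ * g.1.1⁻¹ := by
      simpa [u, v] using congrArg (fun z : G => z.1.1) hc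
    have e₂ : c.1.2 * h₂ * c.1.2⁻¹ = h₂ := by
      simpa [u, v] using congrArg (fun z : G => z.1.2) hc
    have hc2 : c.1.2 ∈ N₂ := hc₂ (Subgroup.mem_centralizer_singleton_iff.2
      (mul_inv_eq_iff_eq_mul.1 e₂))
    have hc1 : c.1.1 ∈ N₁ := by
      have h := G.mul_mem c.2 (G.inv_mem (mem₂.1 hc2))
      rw [mem₁]
      convert h using 1
      ext <;> simp
    have hgc : g.1.1⁻¹ * c.1.1 ∈ N₁ := hc₁ (Subgroup.mem_centralizer_singleton_iff.2 (by
      have e₃ : g.1.1⁻¹ * (c.1.1 * h₁ * c.1.1⁻¹) * c.1.1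
          = g.1.1⁻¹ * (g.1.1 * h₁ * g.1.1⁻¹) * c.1.1 := by rw [e₁]
      simpa [mul_assoc] using e₃))
    have hg1 := N₁.mul_mem hc1 (N₁.inv_mem hgc)
    exact hgN (by simpa using hg1)
  obtain ⟨M, hM, φ, hφ⟩ := hsep _ _ hnc
  obtain ⟨k, hk, hkg⟩ := hC.exists_mem_ker_map_eq π hπ g hp' M hM φ
  have hk1 : k.1.1 ∈ N₁ := (QuotientGroup.eq_one_iff _).1 hk
  let n : G := ⟨(k.1.1, 1), mem₁.1 hk1⟩
  have hku : k * u * k⁻¹ * v = n * (u * v) * n⁻¹ := by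
    ext <;> simp [u, v, n, mul_assoc]
  refine hφ (isConj_iff.2 ⟨φ n, ?_⟩)
  rw [← map_inv, ← map_mul, ← map_mul, ← hku]
  simp only [map_mul, map_inv, hkg]
end

section
/- Let 𝒞 be a pseudovariety of groups, let F be a group, let G ≤ F be a subgroup, and let f ∈ F be an element. If the G-conjugacy class f^G = {gfg⁻¹ : g ∈ G} is closed in the pro-𝒞 topology on F, then the double coset C_F(f)·G = {c·g : c ∈ C_F(f), g ∈ G} is closed in the pro-𝒞 topology on F. -/
/-- Sets saturated under a co-`C` subgroup are open in the pro-`C` topology. -/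
theorem COpen.of_saturated {C : GrpB → Prop} {F : Type} [Group F] {N : Subgroup F}
    (hN : IsCoC C N) {X : Set F} (hX : ∀ y ∈ X, ∀ x, y⁻¹ * x ∈ N → x ∈ X) : COpen C X := by
  have hunion : X = ⋃ y ∈ X, {x : F | y⁻¹ * x ∈ N} := by
    ext x
    simp only [Set.mem_iUnion, Set.mem_ofPred_eq]
    refine ⟨fun hx => ⟨x, hx, by simp⟩, ?_⟩
    rintro ⟨y, hy, hxy⟩
    exact hX y hy x hxy
  let _ := ProCTop C F
  change IsOpen X
  rw [hunion]
  exact isOpen_biUnion fun y _ =>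
    TopologicalSpace.isOpen_generateFrom_of_mem ⟨N, hN, y, rfl⟩

/-- The map `x ↦ x⁻¹ * f * x` is continuous in the pro-`C` topology. -/
theorem continuous_proCTop_inv_mul_mul (C : GrpB → Prop) {F : Type} [Group F] (f : F) :
    @Continuous F F (ProCTop C F) (ProCTop C F) (fun x => x⁻¹ * f * x) := by
  let _ := ProCTop C F
  refine continuous_generateFrom_iff.2 ?_
  rintro _ ⟨N, hN, g, rfl⟩
  refine COpen.of_saturated hN fun y hy x hxy => ?_
  have := hN.1
  simp only [Set.mem_preimage, Set.mem_ofPred_eq, ← QuotientGroup.eq,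
    QuotientGroup.mk_mul, QuotientGroup.mk_inv] at hy hxy ⊢
  rw [← hxy, hy]

/-- `x` lies in `C_F(f)·G` exactly when `x⁻¹ * f * x` is a `G`-conjugate of `f`. -/
theorem exists_centralizer_mul_iff {F : Type} [Group F] (G : Subgroup F) (f x : F) :
    (∃ c ∈ Subgroup.centralizer ({f} : Set F), ∃ g ∈ G, x = c * g) ↔
      ∃ g ∈ G, x⁻¹ * f * x = g * f * g⁻¹ := by
  constructor
  · rintro ⟨c, hc, g, hg, rfl⟩
    rw [Subgroup.mem_centralizer_singleton_iff] at hc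
    refine ⟨g⁻¹, G.inv_mem hg, ?_⟩
    rw [mul_inv_rev, inv_inv, mul_assoc (g⁻¹ * c⁻¹), ← mul_assoc f, ← hc]
    group
  · rintro ⟨g, hg, h⟩
    refine ⟨x * g, ?_, g⁻¹, G.inv_mem hg, by group⟩
    rw [Subgroup.mem_centralizer_singleton_iff]
    calc x * g * f = x * (g * f * g⁻¹) * g := by group
      _ = f * (x * g) := by rw [← h]; group

/-- Lemma 4.15: if the `G`-conjugacy class of `f` is closed in
the pro-`C` topology on `F`, then so is the double coset `C_F(f)·G`. -/
theorem stmt14 (C : GrpB → Prop) (hC : IsPseudovariety C)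
    (F : Type) [Group F] (G : Subgroup F) (f : F)
    (hclosed : CClosed C {x : F | ∃ g ∈ G, x = g * f * g⁻¹}) :
    CClosed C {x : F | ∃ c ∈ Subgroup.centralizer ({f} : Set F), ∃ g ∈ G, x = c * g} := by
  have hpre := @IsClosed.preimage F F (ProCTop C F) (ProCTop C F) _
    (continuous_proCTop_inv_mul_mul C f) _ hclosed
  have heq : {x : F | ∃ c ∈ Subgroup.centralizer ({f} : Set F), ∃ g ∈ G, x = c * g} =
      (fun x => x⁻¹ * f * x) ⁻¹' {x : F | ∃ g ∈ G, x = g * f * g⁻¹} :=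
    Set.ext fun x => exists_centralizer_mul_iff G f x
  rw [heq]
  exact hpre
end

section
/- Let P be a finitely generated group with a finitely generated subgroup Q ≤ P. Then for every integer k ≥ 2 there exist a finitely generated free group F, an automorphism σ of F, and a surjective homomorphism ψ : F → P such that: the order of σ in Aut(F) is k; ψ(Fix(σ)) = Q, where Fix(σ) = {h ∈ F : σ(h) = h}; and σ induces the identity automorphism of P, i.e., σ(ker ψ) = ker ψ and ψ(σ(f)) = ψ(f) for all f ∈ F. -/
/-- An injective relabelling of the generators commutes with taking reduced words. -/
theorem FreeGroup.toWord_map_of_injective {α β : Type*} [DecidableEq α] [DecidableEq β]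
    {f : α → β} (hf : Function.Injective f) (x : FreeGroup α) :
    (FreeGroup.map f x).toWord = x.toWord.map fun a => (f a.1, a.2) := by
  have hred : FreeGroup.IsReduced (x.toWord.map fun a => (f a.1, a.2)) :=
    List.isChain_map_of_isChain _ (fun a b h hab => h (hf hab)) FreeGroup.isReduced_toWord
  conv_lhs => rw [← FreeGroup.mk_toWord (x := x)]
  rw [FreeGroup.map.mk, FreeGroup.toWord_mk, hred.reduce_eq]

/-- A word all of whose letters lie in `s` represents an element of the subgroup generated
by `s`. -/
theorem FreeGroup.mk_mem_closure_of_image {α : Type*} {s : Set α} {L : List (α × Bool)}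
    (h : ∀ a ∈ L, a.1 ∈ s) : FreeGroup.mk L ∈ Subgroup.closure (FreeGroup.of '' s) := by
  rw [← FreeGroup.lift_of_apply (FreeGroup.mk L), FreeGroup.lift_mk]
  refine Subgroup.list_prod_mem _ fun y hy => ?_
  obtain ⟨⟨a, b⟩, ha, rfl⟩ := List.mem_map.1 hy
  have hmem : FreeGroup.of a ∈ Subgroup.closure (FreeGroup.of '' s) :=
    Subgroup.subset_closure ⟨a, h _ ha, rfl⟩
  cases b
  · exact inv_mem hmem
  · exact hmem

/-- The fixed elements of an automorphism permuting a basis are generated by the fixed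
basis elements. -/
theorem FreeGroup.map_eq_self_iff_mem_closure {α : Type*} {f : α → α}
    (hf : Function.Injective f) (x : FreeGroup α) :
    FreeGroup.map f x = x ↔ x ∈ Subgroup.closure (FreeGroup.of '' {a | f a = a}) := by
  classical
  constructor
  · intro hx
    have hword := FreeGroup.toWord_map_of_injective hf x
    rw [hx] at hword
    rw [← FreeGroup.mk_toWord (x := x)]
    refine FreeGroup.mk_mem_closure_of_image fun a ha => ?_
    have hfix := List.map_eq_map_iff.1 ((List.map_id _).trans hword) a ha
    exact (congrArg Prod.fst hfix).symm
  · intro hx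
    have hle : Subgroup.closure (FreeGroup.of '' {a | f a = a}) ≤
        (FreeGroup.map f).eqLocus (MonoidHom.id _) := by
      rw [Subgroup.closure_le]
      rintro _ ⟨a, ha, rfl⟩
      exact (FreeGroup.map.of).trans (congrArg FreeGroup.of ha)
    exact hle hx

/-- The action of permutations of a basis on a free group. -/
def FreeGroup.permAut (α : Type*) : Equiv.Perm α →* MulAut (FreeGroup α) where
  toFun := FreeGroup.freeGroupCongr
  map_one' := FreeGroup.freeGroupCongr_refl
  map_mul' e f := (FreeGroup.freeGroupCongr_trans f e).symm

theorem FreeGroup.permAut_apply {α : Type*} (e : Equiv.Perm α) (x : FreeGroup α) :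
    FreeGroup.permAut α e x = FreeGroup.map e x := rfl

theorem FreeGroup.permAut_injective (α : Type*) :
    Function.Injective (FreeGroup.permAut α) := by
  intro e f h
  ext a
  have ha := DFunLike.congr_fun h (FreeGroup.of a)
  rw [FreeGroup.permAut_apply, FreeGroup.permAut_apply, FreeGroup.map.of,
    FreeGroup.map.of] at ha
  exact FreeGroup.of_injective ha

/-- The permutation of `ZMod k × A ⊕ B` that cyclically shifts the first coordinate of
`ZMod k × A` and fixes `B`. -/
def cyclicShift (k : ℕ) (A B : Type*) : Equiv.Perm (ZMod k × A ⊕ B) :=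
  Equiv.sumCongr (Equiv.prodCongr (Equiv.addRight 1) (Equiv.refl A)) (Equiv.refl B)

theorem cyclicShift_inl (k : ℕ) {A B : Type*} (i : ZMod k) (a : A) :
    cyclicShift k A B (Sum.inl (i, a)) = Sum.inl (i + 1, a) := rfl

theorem cyclicShift_inr (k : ℕ) {A B : Type*} (b : B) :
    cyclicShift k A B (Sum.inr b) = Sum.inr b := rfl

theorem cyclicShift_pow_inl (k : ℕ) {A B : Type*} (m : ℕ) (i : ZMod k) (a : A) :
    (cyclicShift k A B ^ m) (Sum.inl (i, a)) = Sum.inl (i + m, a) := by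
  induction m with
  | zero => simp
  | succ m ih =>
    rw [pow_succ', Equiv.Perm.mul_apply, ih, cyclicShift_inl, Nat.cast_succ, add_assoc]

theorem cyclicShift_pow_inr (k : ℕ) {A B : Type*} (m : ℕ) (b : B) :
    (cyclicShift k A B ^ m) (Sum.inr b) = Sum.inr b :=
  Equiv.Perm.pow_apply_eq_self_of_apply_eq_self (cyclicShift_inr k b) m

theorem orderOf_cyclicShift (k : ℕ) (A B : Type*) [Nonempty A] :
    orderOf (cyclicShift k A B) = k := by
  refine Nat.dvd_right_iff_eq.1 fun m => ?_
  rw [orderOf_dvd_iff_pow_eq_one, ← ZMod.natCast_eq_zero_iff]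
  constructor
  · intro h
    obtain ⟨a⟩ := ‹Nonempty A›
    have ha := DFunLike.congr_fun h (Sum.inl (0, a))
    rw [cyclicShift_pow_inl] at ha
    simpa using ha
  · intro h
    ext (⟨i, a⟩ | b)
    · rw [cyclicShift_pow_inl, h, add_zero, Equiv.Perm.one_apply]
    · rw [cyclicShift_pow_inr, Equiv.Perm.one_apply]

theorem setOf_cyclicShift_eq_self {k : ℕ} (hk : 2 ≤ k) (A B : Type*) :
    {x | cyclicShift k A B x = x} = Set.range Sum.inr := by
  have : Fact (1 < k) := ⟨hk⟩
  ext (⟨i, a⟩ | b)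
  · simp [cyclicShift_inl]
  · simp [cyclicShift_inr]

/-- Lemma 5.1: for a finitely generated group `P` with a
finitely generated subgroup `Q` and any `k ≥ 2`, there are a finitely generated
free group `F`, an automorphism `σ` of order `k` and an epimorphism `ψ : F → P`
with `ψ(Fix σ) = Q` such that `σ` induces the identity on `P`. -/
theorem stmt16 (P : Type) [Group P] (hP : Group.FG P) (Q : Subgroup P) (hQ : Q.FG)
    (k : ℕ) (hk : 2 ≤ k) :
    ∃ F : GrpB, (∃ S : Type, Finite S ∧ Nonempty (F.carrier ≃* FreeGroup S)) ∧
      ∃ σ : MulAut F.carrier, orderOf σ = k ∧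
        ∃ ψ : F.carrier →* P, Function.Surjective ψ ∧
          (⇑ψ '' {h : F.carrier | σ h = h} = (Q : Set P)) ∧
          Subgroup.map σ.toMonoidHom ψ.ker = ψ.ker ∧
          ∀ f : F.carrier, ψ (σ f) = ψ f := by
  obtain ⟨S, hS⟩ := hP.out
  obtain ⟨T, hT⟩ := hQ
  have : NeZero k := ⟨by omega⟩
  let α : Type := ZMod k × Option S ⊕ T
  let g : α → P := Sum.elim (fun x => x.2.elim 1 (↑)) (↑)
  let ψ : FreeGroup α →* P := FreeGroup.lift g
  let e : Equiv.Perm α := cyclicShift k (Option S) T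
  let σ : MulAut (FreeGroup α) := FreeGroup.permAut α e
  have hψσ : ∀ f, ψ (σ f) = ψ f := by
    refine DFunLike.congr_fun (f := ψ.comp σ.toMonoidHom) (FreeGroup.ext_hom _ _ fun x => ?_)
    change ψ (FreeGroup.map e (FreeGroup.of x)) = ψ (FreeGroup.of x)
    rw [FreeGroup.map.of, FreeGroup.lift_apply_of, FreeGroup.lift_apply_of]
    rcases x with ⟨i, a⟩ | b <;> rfl
  have hfix : {h | σ h = h} =
      ↑(Subgroup.closure (FreeGroup.of '' Set.range (Sum.inr : T → α))) := by
    rw [← setOf_cyclicShift_eq_self hk]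
    ext x
    exact FreeGroup.map_eq_self_iff_mem_closure e.injective x
  refine ⟨GrpB.of (FreeGroup α), ⟨α, inferInstance, ⟨MulEquiv.refl _⟩⟩, σ, ?_, ψ, ?_, ?_, ?_,
    hψσ⟩
  · exact (orderOf_injective _ (FreeGroup.permAut_injective α) e).trans
      (orderOf_cyclicShift k (Option S) T)
  · refine MonoidHom.range_eq_top.1 (eq_top_iff.2 ?_)
    rw [← hS]
    refine (Subgroup.closure_le _).2 fun s hs => ?_
    exact ⟨FreeGroup.of (Sum.inl (0, some ⟨s, hs⟩)), FreeGroup.lift_apply_of⟩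
  · change ψ '' {h | σ h = h} = Q
    rw [hfix, ← Subgroup.coe_map, MonoidHom.map_closure, ← hT, ← Set.range_comp,
      ← Set.range_comp]
    congr 2
    have hg : ψ ∘ FreeGroup.of ∘ Sum.inr = ((↑) : T → P) :=
      funext fun b => FreeGroup.lift_apply_of
    exact (congrArg Set.range hg).trans Subtype.range_coe
  · ext x
    constructor
    · rintro ⟨y, hy, rfl⟩
      exact (hψσ y).trans hy
    · intro hx
      refine ⟨σ.symm x, ?_, σ.apply_symm_apply x⟩
      exact ((hψσ _).symm.trans (congrArg ψ (σ.apply_symm_apply x))).trans hx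
end

section
/- Let G be a group with a subgroup H ≤ G of index 2. Then there exist a group K, an injective homomorphism ι : G → K with ι(G) of index 3 in K, and an element a ∈ K centralizing ι(H), such that for any x ∈ H and y ∈ G: x is conjugate to y by an element of H if and only if a·ι(x) is conjugate to a·ι(y) in K. -/
/-- The action of `G` on an abelian group `A` in which an index-two subgroup `H` acts trivially
and the other coset acts by inversion. -/
noncomputable def signAction {G : Type*} [Group G] {H : Subgroup G} (hH : H.index = 2)
    (A : Type*) [CommGroup A] : G →* MulAut A := by
  classical
  exact
    { toFun := fun g => if g ∈ H then 1 else MulEquiv.inv A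
      map_one' := by simp
      map_mul' := fun g k => by
        by_cases hg : g ∈ H <;> by_cases hk : k ∈ H <;>
          simp [Subgroup.mul_mem_iff_of_index_two hH, hg, hk]
        ext
        simp }

theorem signAction_of_mem {G : Type*} [Group G] {H : Subgroup G} (hH : H.index = 2)
    (A : Type*) [CommGroup A] {g : G} (hg : g ∈ H) : signAction hH A g = 1 :=
  if_pos hg

theorem signAction_of_notMem {G : Type*} [Group G] {H : Subgroup G} (hH : H.index = 2)
    (A : Type*) [CommGroup A] {g : G} (hg : g ∉ H) : signAction hH A g = MulEquiv.inv A :=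
  if_neg hg

theorem SemidirectProduct.isComplement'_range_inl_range_inr {N G : Type*} [Group N] [Group G]
    (φ : G →* MulAut N) :
    (inl : N →* N ⋊[φ] G).range.IsComplement' (inr : G →* N ⋊[φ] G).range := by
  apply Subgroup.isComplement'_of_disjoint_and_mul_eq_univ
  · rw [Subgroup.disjoint_def]
    rintro _ ⟨n, rfl⟩ ⟨g, hg⟩
    have h := congrArg left hg
    simp only [left_inr, left_inl] at h
    simp [← h]
  · refine Set.eq_univ_of_forall fun x => ?_
    exact ⟨_, ⟨x.left, rfl⟩, _, ⟨x.right, rfl⟩, inl_left_mul_inr_right x⟩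

theorem SemidirectProduct.index_range_inr {N G : Type*} [Group N] [Group G]
    (φ : G →* MulAut N) : (inr : G →* N ⋊[φ] G).range.index = Nat.card N := by
  rw [(isComplement'_range_inl_range_inr φ).index_eq_card]
  exact (Nat.card_congr (MonoidHom.ofInjective inl_injective).toEquiv).symm

/-- Lemma 6.1: for a subgroup `H ≤ G` of index 2 there are an
overgroup `K` of index 3 and an element `a ∈ K` centralizing `H` such that, for
`x ∈ H` and `y ∈ G`, `x ∼_H y` iff `a·x ∼_K a·y`. -/
theorem stmt17 (G : Type) [Group G] (H : Subgroup G) (hH : H.index = 2) :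
    ∃ K : GrpB, ∃ ι : G →* K.carrier, Function.Injective ι ∧ ι.range.index = 3 ∧
      ∃ a : K.carrier, (∀ h ∈ H, a * ι h = ι h * a) ∧
        ∀ x ∈ H, ∀ y : G,
          (∃ h ∈ H, x = h * y * h⁻¹) ↔ IsConj (a * ι x) (a * ι y) := by
  let A := Multiplicative (ZMod 3)
  let t : A := Multiplicative.ofAdd 1
  have ht : t⁻¹ ≠ t := by decide
  refine ⟨⟨A ⋊[signAction hH A] G, inferInstance⟩, SemidirectProduct.inr,
    SemidirectProduct.inr_injective, ?_, SemidirectProduct.inl t, ?_, ?_⟩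
  · exact (SemidirectProduct.index_range_inr _).trans (Nat.card_zmod 3)
  · intro h hh
    ext <;> simp [signAction_of_mem hH A hh]
  · intro x hx y
    rw [isConj_comm, isConj_iff]
    constructor
    · rintro ⟨h, hh, rfl⟩
      refine ⟨SemidirectProduct.inr h, ?_⟩
      ext <;> simp [signAction_of_mem hH A hh, mul_assoc]
    · rintro ⟨c, hc⟩
      rw [mul_inv_eq_iff_eq_mul] at hc
      have hr := congrArg SemidirectProduct.right hc
      have hl := congrArg SemidirectProduct.left hc
      simp only [SemidirectProduct.mul_right, SemidirectProduct.mul_left,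
        SemidirectProduct.right_inl, SemidirectProduct.left_inl, SemidirectProduct.right_inr,
        SemidirectProduct.left_inr, map_one, one_mul, mul_one,
        signAction_of_mem hH A hx, MulAut.one_apply] at hr hl
      rw [mul_comm t] at hl
      refine ⟨c.right, ?_, by rw [hr, mul_inv_cancel_right]⟩
      by_contra hcH
      rw [signAction_of_notMem hH A hcH] at hl
      exact ht (mul_left_cancel hl)
end

section
/- Let G be a group with a subgroup H ≤ G of finite index k. Then there exist a group K, an injective homomorphism ι : G → K with ι(G) of index 2^k in K, and an element a ∈ K centralizing ι(H), such that for any x ∈ H and y ∈ G: x is conjugate to y by an element of H if and only if a·ι(x) is conjugate to a·ι(y) in K. -/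
namespace SemidirectProduct

theorem isComplement'_range_inl_range_inr_s18 {N G : Type*} [Group N] [Group G] (φ : G →* MulAut N) :
    Subgroup.IsComplement' (inl : N →* N ⋊[φ] G).range (inr : G →* N ⋊[φ] G).range := by
  refine Subgroup.isComplement'_of_disjoint_and_mul_eq_univ ?_ ?_
  · rw [Subgroup.disjoint_def]
    rintro _ ⟨n, rfl⟩ ⟨g, hg⟩
    have h : n = 1 := by simpa using (congrArg left hg).symm
    simp [h]
  · refine Set.eq_univ_of_forall fun x => ?_
    exact Set.mem_mul.2 ⟨inl x.left, ⟨_, rfl⟩, inr x.right, ⟨_, rfl⟩, inl_left_mul_inr_right x⟩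

theorem index_range_inr_s18 {N G : Type*} [Group N] [Group G] (φ : G →* MulAut N) :
    (inr : G →* N ⋊[φ] G).range.index = Nat.card N := by
  rw [(isComplement'_range_inl_range_inr_s18 φ).index_eq_card]
  exact Nat.card_congr (MonoidHom.ofInjective inl_injective).toEquiv.symm

end SemidirectProduct

/-- Proposition 6.4: for a subgroup `H ≤ G` of finite index
`k` there are an overgroup `K` of index `2^k` and an element `a ∈ K`
centralizing `H` such that, for `x ∈ H` and `y ∈ G`, `x ∼_H y` iff
`a·x ∼_K a·y`. -/
theorem stmt18 (G : Type) [Group G] (H : Subgroup G) (k : ℕ) (hk : 0 < k)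
    (hH : H.index = k) :
    ∃ K : GrpB, ∃ ι : G →* K.carrier, Function.Injective ι ∧ ι.range.index = 2 ^ k ∧
      ∃ a : K.carrier, (∀ h ∈ H, a * ι h = ι h * a) ∧
        ∀ x ∈ H, ∀ y : G,
          (∃ h ∈ H, x = h * y * h⁻¹) ↔ IsConj (a * ι x) (a * ι y) := by
  classical
  let φ : G →* MulAut (G ⧸ H → Multiplicative (ZMod 2)) := mulAutArrow
  have hφ : ∀ g f q, φ g f q = f (g⁻¹ • q) := fun _ _ _ => rfl
  let δ : G ⧸ H → Multiplicative (ZMod 2) :=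
    Pi.mulSingle ((1 : G) : G ⧸ H) (Multiplicative.ofAdd 1)
  have hfin : Finite (G ⧸ H) := Nat.finite_of_card_ne_zero (by
    rw [← Subgroup.index_eq_card, hH]
    exact hk.ne')
  have hcomm : ∀ h ∈ H, (SemidirectProduct.inl δ * SemidirectProduct.inr h :
      SemidirectProduct _ _ φ) = SemidirectProduct.inr h * SemidirectProduct.inl δ := by
    intro h hh
    ext q
    · have hq : h⁻¹ • q = ((1 : G) : G ⧸ H) ↔ q = ((1 : G) : G ⧸ H) := by
        rw [inv_smul_eq_iff]
        have : h • ((1 : G) : G ⧸ H) = ((1 : G) : G ⧸ H) := by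
          rw [MulAction.Quotient.smul_coe, QuotientGroup.eq]
          simpa using hh
        rw [this]
      simp [hφ, δ, Pi.mulSingle_apply, hq]
    · simp
  have hconj : ∀ x ∈ H, ∀ y : G, (∃ h ∈ H, x = h * y * h⁻¹) ↔
      IsConj (SemidirectProduct.inl δ * SemidirectProduct.inr x : SemidirectProduct _ _ φ)
        (SemidirectProduct.inl δ * SemidirectProduct.inr y) := by
    intro x hx y
    constructor
    · rintro ⟨h, hh, rfl⟩
      refine IsConj.symm (isConj_iff.2 ⟨SemidirectProduct.inr h, ?_⟩)
      rw [← mul_assoc, ← hcomm h hh, map_mul, map_mul, map_inv]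
      simp only [mul_assoc]
    · intro hc
      obtain ⟨c, hc⟩ := isConj_iff.1 hc
      rw [mul_inv_eq_iff_eq_mul] at hc
      obtain ⟨f, g⟩ := c
      have hy : g * x = y * g := by simpa using congrArg SemidirectProduct.right hc
      have hfix : y⁻¹ • (g : G ⧸ H) = g := by
        rw [inv_smul_eq_iff, MulAction.Quotient.smul_coe, smul_eq_mul, ← hy, QuotientGroup.eq]
        simpa using hx
      have hl := congrFun (congrArg SemidirectProduct.left hc) (g : G ⧸ H)
      have hg1 : g⁻¹ • (g : G ⧸ H) = ((1 : G) : G ⧸ H) := by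
        rw [MulAction.Quotient.smul_coe]
        simp
      have hδ : δ ((1 : G) : G ⧸ H) = δ (g : G ⧸ H) := by
        simp only [SemidirectProduct.mul_left, SemidirectProduct.mul_right,
          SemidirectProduct.left_inl, SemidirectProduct.right_inl, SemidirectProduct.left_inr,
          SemidirectProduct.right_inr, Pi.mul_apply, hφ, map_one, mul_one, one_mul, hg1,
          hfix] at hl
        rw [mul_comm] at hl
        exact mul_right_cancel hl
      have hg : g ∈ H := by
        have : (g : G ⧸ H) = ((1 : G) : G ⧸ H) := by
          by_contra hne
          simp [δ, hne] at hδ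
        simpa using (QuotientGroup.eq.1 this)
      refine ⟨g⁻¹, H.inv_mem hg, ?_⟩
      rw [inv_inv, mul_assoc, ← hy, inv_mul_cancel_left]
  refine ⟨GrpB.of (SemidirectProduct _ _ φ), SemidirectProduct.inr,
    SemidirectProduct.inr_injective, ?_, SemidirectProduct.inl δ, hcomm, hconj⟩
  refine (SemidirectProduct.index_range_inr_s18 φ).trans ?_
  rw [Nat.card_fun, ← Subgroup.index_eq_card, hH]
  simp
end

section
/- Let Q be a set of primes and let 𝒞 be a pseudovariety of Q'-groups. Let F₁ and F₂ be groups, let G ≤ F₁ × F₂ be a subgroup whose image under the first-coordinate projection ρ₁ : F₁ × F₂ → F₁ is all of F₁, and let N₁ := G ∩ F₁. If x₁ ∈ F₁ and (y₁, y₂) ∈ G are elements such that y₁ ∈ N₁·x₁^q for some q ∈ Q, then (x₁y₁x₁⁻¹, y₂) ∈ G and for every M ∈ 𝒞 and every homomorphism φ : G → M, φ((x₁y₁x₁⁻¹, y₂)) ∈ φ((y₁,y₂)^{N₁}); i.e., (x₁y₁x₁⁻¹, y₂) belongs to the closure of the N₁-conjugacy class (y₁,y₂)^{N₁} in the pro-𝒞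 topology on G. -/
/-- Every neighbourhood of `p` in the pro-`C` topology is everything or contains a fibre through `p`
of a homomorphism to a member of `C`. -/
theorem eq_univ_or_exists_fibre_subset_of_cOpen {C : GrpB → Prop} (hC : IsPseudovariety C)
    {F : Type} [Group F] {U : Set F} (hU : COpen C U) {p : F} (hp : p ∈ U) :
    U = Set.univ ∨ ∃ M : GrpB, C M ∧ ∃ φ : F →* M.carrier, {x | φ x = φ p} ⊆ U := by
  induction hU with
  | basic S hS =>
    obtain ⟨N, ⟨hN, hCN⟩, g, rfl⟩ := hS
    refine Or.inr ⟨_, hCN, QuotientGroup.mk' N, fun x hx => ?_⟩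
    have h : p⁻¹ * x ∈ N := QuotientGroup.eq.mp (Eq.symm hx)
    simpa [mul_assoc] using N.mul_mem hp h
  | univ => exact Or.inl rfl
  | inter S T _ _ ihS ihT =>
    rcases ihS hp.1 with rfl | ⟨A, hA, φ, hφ⟩
    · simpa using ihT hp.2
    rcases ihT hp.2 with rfl | ⟨B, hB, ψ, hψ⟩
    · simpa using Or.inr ⟨A, hA, φ, hφ⟩
    · refine Or.inr ⟨_, hC.2.2.1 A B hA hB, φ.prod ψ, fun x hx => ?_⟩
      have h : (φ x, ψ x) = (φ p, ψ p) := hx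
      exact ⟨hφ (Prod.ext_iff.mp h).1, hψ (Prod.ext_iff.mp h).2⟩
  | sUnion 𝒮 _ ih =>
    obtain ⟨S, hS, hpS⟩ := hp
    rcases ih S hS hpS with rfl | ⟨A, hA, φ, hφ⟩
    · exact Or.inl (Set.eq_univ_of_univ_subset (Set.subset_sUnion_of_mem hS))
    · exact Or.inr ⟨A, hA, φ, hφ.trans (Set.subset_sUnion_of_mem hS)⟩

/-- A point whose images in members of `C` all lie in the images of a nonempty set `X` belongs to
the pro-`C` closure of `X`. -/
theorem mem_cClosure_of_forall_mem_image {C : GrpB → Prop} (hC : IsPseudovariety C)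
    {F : Type} [Group F] {X : Set F} (hX : X.Nonempty) {p : F}
    (h : ∀ M : GrpB, C M → ∀ φ : F →* M.carrier, φ p ∈ φ '' X) : p ∈ CClosure C X := by
  let := ProCTop C F
  refine mem_closure_iff.mpr fun U hU hp => ?_
  rcases eq_univ_or_exists_fibre_subset_of_cOpen hC hU hp with rfl | ⟨M, hM, φ, hφ⟩
  · simpa using hX
  · obtain ⟨z, hz, hzp⟩ := h M hM φ
    exact ⟨z, hφ hzp, hz⟩

/-- In a group, an element of finite order prime to `q` is a power of its `q`-th power. -/
theorem exists_pow_mul_eq_self_of_coprime_orderOf {M : Type*} [Group M] {g : M} {q : ℕ}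
    (h : (orderOf g).Coprime q) : ∃ k : ℕ, g ^ (q * k) = g := by
  obtain ⟨k, hk⟩ := exists_pow_eq_self_of_coprime h.symm
  exact ⟨k, by rw [pow_mul, hk]⟩

/-- Lemma 7.3: for a pseudovariety `C` of `Q'`-groups, if
`y₁ ∈ N₁·x₁^q` for some `q ∈ Q` then `(x₁y₁x₁⁻¹, y₂) ∈ G` and its image under any
homomorphism to a member of `C` lies in the image of the `N₁`-conjugacy class of
`(y₁, y₂)`; i.e. it lies in the pro-`C` closure of that class in `G`. -/
theorem stmt19 (Q : Set ℕ) (hQ : ∀ q ∈ Q, Nat.Prime q)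
    (C : GrpB → Prop) (hC : IsPseudovariety C)
    (hCQ : ∀ A : GrpB, C A → IsQPrimeGroup Q A.carrier)
    (F₁ F₂ : Type) [Group F₁] [Group F₂]
    (G : Subgroup (F₁ × F₂)) (hG : Subgroup.map (MonoidHom.fst F₁ F₂) G = ⊤)
    (N₁ : Subgroup F₁) (hN₁ : N₁ = Subgroup.comap (MonoidHom.inl F₁ F₂) G)
    (x₁ y₁ : F₁) (y₂ : F₂) (hy : ((y₁, y₂) : F₁ × F₂) ∈ G)
    (q : ℕ) (hq : q ∈ Q) (hyx : ∃ n ∈ N₁, y₁ = n * x₁ ^ q) :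
    ∃ hmem : ((x₁ * y₁ * x₁⁻¹, y₂) : F₁ × F₂) ∈ G,
      (∀ M : GrpB, C M → ∀ φ : ↥G →* M.carrier,
        φ ⟨(x₁ * y₁ * x₁⁻¹, y₂), hmem⟩ ∈
          ⇑φ '' {z : ↥G | ∃ n ∈ N₁,
            (z : F₁ × F₂) = (n, (1 : F₂)) * (y₁, y₂) * (n, (1 : F₂))⁻¹}) ∧
      (⟨(x₁ * y₁ * x₁⁻¹, y₂), hmem⟩ : ↥G) ∈
        CClosure C {z : ↥G | ∃ n ∈ N₁,
          (z : F₁ × F₂) = (n, (1 : F₂)) * (y₁, y₂) * (n, (1 : F₂))⁻¹} := by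
  have normal : N₁.Normal := by
    refine ⟨fun n hn f => ?_⟩
    obtain ⟨⟨f', b⟩, hb, rfl⟩ : f ∈ Subgroup.map (MonoidHom.fst F₁ F₂) G := hG ▸ Subgroup.mem_top f
    subst hN₁
    simpa using G.mul_mem (G.mul_mem hb hn) (G.inv_mem hb)
  have mem_iff (n : F₁) : n ∈ N₁ ↔ ((n, 1) : F₁ × F₂) ∈ G := by
    subst hN₁
    rfl
  obtain ⟨n, hn, rfl⟩ := hyx
  have comm_mem (j : ℕ) : x₁ ^ j * n * (x₁ ^ j)⁻¹ * n⁻¹ ∈ N₁ :=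
    N₁.mul_mem (normal.conj_mem n hn _) (N₁.inv_mem hn)
  have conj_eq (j : ℕ) : ((x₁ ^ j * (n * x₁ ^ q) * (x₁ ^ j)⁻¹, y₂) : F₁ × F₂) =
      (x₁ ^ j * n * (x₁ ^ j)⁻¹ * n⁻¹, 1) * (n * x₁ ^ q, y₂) := by
    have h : x₁ ^ q * (x₁ ^ j)⁻¹ = (x₁ ^ j)⁻¹ * x₁ ^ q :=
      ((Commute.refl x₁).pow_pow q j).inv_right.eq
    simp [mul_assoc, h]
  have conj_mem (j : ℕ) : ((x₁ ^ j * (n * x₁ ^ q) * (x₁ ^ j)⁻¹, y₂) : F₁ × F₂) ∈ G :=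
    conj_eq j ▸ G.mul_mem ((mem_iff _).mp (comm_mem j)) hy
  have hmem : ((x₁ * (n * x₁ ^ q) * x₁⁻¹, y₂) : F₁ × F₂) ∈ G := by simpa using conj_mem 1
  have image_mem : ∀ M : GrpB, C M → ∀ φ : ↥G →* M.carrier,
      φ ⟨(x₁ * (n * x₁ ^ q) * x₁⁻¹, y₂), hmem⟩ ∈ ⇑φ '' {z : ↥G | ∃ m ∈ N₁,
        (z : F₁ × F₂) = (m, (1 : F₂)) * (n * x₁ ^ q, y₂) * (m, (1 : F₂))⁻¹} := by
    intro M hM φ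
    obtain ⟨⟨x, a⟩, hg, rfl⟩ : x₁ ∈ Subgroup.map (MonoidHom.fst F₁ F₂) G :=
      hG ▸ Subgroup.mem_top x₁
    simp only [MonoidHom.coe_fst] at *
    let g : G := ⟨(x, a), hg⟩
    let ν : G := ⟨(n, 1), (mem_iff n).mp hn⟩
    let y : G := ⟨(n * x ^ q, y₂), hy⟩
    have image_eq (j : ℕ) : φ ⟨_, conj_mem j⟩ =
        φ g ^ j * φ ν * (φ g ^ j)⁻¹ * (φ ν)⁻¹ * φ y := by
      simp only [← map_pow, ← map_mul, ← map_inv]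
      congr 1
      apply Subtype.ext
      simp [conj_eq, g, ν, y]
    obtain ⟨k, hk⟩ := exists_pow_mul_eq_self_of_coprime_orderOf ((hCQ M hM (φ g)).2 q hq)
    refine ⟨⟨_, conj_mem (q * k)⟩, ⟨x ^ (q * k) * ((n * x ^ q) ^ k)⁻¹, ?_, ?_⟩, ?_⟩
    · rw [← QuotientGroup.eq_one_iff]
      have h : (n : F₁ ⧸ N₁) = 1 := (QuotientGroup.eq_one_iff n).mpr hn
      simp [h, pow_mul]
    · have h : ((n * x ^ q) ^ k)⁻¹ * (n * x ^ q) * (n * x ^ q) ^ k = n * x ^ q := by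
        rw [mul_assoc, ← pow_succ', pow_succ, inv_mul_cancel_left]
      ext
      · calc _ = x ^ (q * k) * (((n * x ^ q) ^ k)⁻¹ * (n * x ^ q) * (n * x ^ q) ^ k) *
              (x ^ (q * k))⁻¹ := by rw [h]
          _ = _ := by simp only [Prod.fst_mul, Prod.fst_inv]; group
      · simp
    · have h := image_eq 1
      simp only [pow_one] at h
      rw [image_eq, hk, h]
  refine ⟨hmem, image_mem, mem_cClosure_of_forall_mem_image hC ?_ image_mem⟩
  exact ⟨⟨_, hy⟩, 1, N₁.one_mem, by simp⟩
end
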